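/- Let K be a number field with r_1 real embeddings and r_2 conjugate pairs of complex embeddings, and n_K = r_1 + 2r_2. Define E_K(T,d) = (r_1 + r_2)·E_0(T,d) + r_2·E_1(T,d), with E_a(T,d) as in the context. Then: (i) for all 0 ≤ δ_1 ≤ d < 9/2 and T ≥ 5/7, one has 0 < E_K(T,δ_1) ≤ E_K(T,d); and (ii) for all d ∈ [1/4, 5/8] and T ≥ 5/7, one has E_K(T,d)/π ≤ (r_1 + r_2)·(640d − 112)/(1536(3T − 1)) + r_2·((640 + 216)d − 112 − 39)/(1536(3T + 3 − 1)) + n_K/2^{10}. -/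

import Mathlib

open Complex NumberField

/-- The function `E_a(T,d)` of Bennett–Martin–O'Bryant–Rechnitzer. -/
noncomputable def Efun (a T d : ℝ) : ℝ :=
  (2 * T / 3) / ((2 * a + 2 * d + 17) ^ 2 + 4 * T ^ 2)
    + (2 * T / 3) / ((2 * a - 2 * d + 17) ^ 2 + 4 * T ^ 2)
    - (4 * T / 3) / ((2 * a + 17) ^ 2 + 4 * T ^ 2)
    + T / 2 * Real.log (1 + (2 * a + 17) ^ 2 / (4 * T ^ 2))
    - T / 4 * Real.log (1 + (2 * a + 2 * d + 17) ^ 2 / (4 * T ^ 2))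
    - T / 4 * Real.log (1 + (2 * a - 2 * d + 17) ^ 2 / (4 * T ^ 2))
    + ((8 + 6 * Real.pi) / 45) / ((2 * a + 2 * d + 17) ^ 2 + 4 * T ^ 2) ^ ((3 : ℝ) / 2)
    + ((8 + 6 * Real.pi) / 45) / ((2 * a - 2 * d + 17) ^ 2 + 4 * T ^ 2) ^ ((3 : ℝ) / 2)
    + 2 * ((8 + 6 * Real.pi) / 45) / ((2 * a + 17) ^ 2 + 4 * T ^ 2) ^ ((3 : ℝ) / 2)
    + ∑ k ∈ Finset.range 4,
        (2 * Real.arctan ((2 * a + 1 + 4 * (k : ℝ)) / (2 * T))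
          - Real.arctan ((2 * a + 2 * d + 1 + 4 * (k : ℝ)) / (2 * T))
          - Real.arctan ((2 * a - 2 * d + 1 + 4 * (k : ℝ)) / (2 * T)))
    + (2 * a + 2 * d + 15) / 4 * Real.arctan ((2 * a + 2 * d + 17) / (2 * T))
    + (2 * a - 2 * d + 15) / 4 * Real.arctan ((2 * a - 2 * d + 17) / (2 * T))
    - (2 * a + 15) / 2 * Real.arctan ((2 * a + 17) / (2 * T))

/-- `E_K(T,d) = (r₁ + r₂) E₀(T,d) + r₂ E₁(T,d)`. -/
noncomputable def EK (r₁ r₂ : ℕ) (T d : ℝ) : ℝ :=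
  ((r₁ : ℝ) + r₂) * Efun 0 T d + (r₂ : ℝ) * Efun 1 T d

noncomputable def gg (T x : ℝ) : ℝ :=
  (2 * T / 3) / (x ^ 2 + 4 * T ^ 2) - T / 4 * Real.log (1 + x ^ 2 / (4 * T ^ 2))
    + (x - 2) / 4 * Real.arctan (x / (2 * T))

noncomputable def gg1 (T x : ℝ) : ℝ :=
  Real.arctan (x / (2 * T)) / 4 - T / (x ^ 2 + 4 * T ^ 2)
    - (4 * T / 3) * x / (x ^ 2 + 4 * T ^ 2) ^ 2

noncomputable def gg2 (T x : ℝ) : ℝ :=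
  T / (2 * (x ^ 2 + 4 * T ^ 2)) + 2 * T * x / (x ^ 2 + 4 * T ^ 2) ^ 2
    - (4 * T / 3) * (4 * T ^ 2 - 3 * x ^ 2) / (x ^ 2 + 4 * T ^ 2) ^ 3

lemma arctan_scaled_deriv (T x : ℝ) (hT : 0 < T) :
    HasDerivAt (fun x => Real.arctan (x / (2 * T))) (2 * T / (x ^ 2 + 4 * T ^ 2)) x := by
  have h := ((hasDerivAt_id x).div_const (2 * T)).arctan
  refine h.congr_deriv ?_
  have : 0 < x ^ 2 + 4 * T ^ 2 := by positivity
  have : 0 < 1 + (x / (2 * T)) ^ 2 := by positivity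
  simp only [id]
  field_simp
  ring

lemma quad_deriv (T x : ℝ) : HasDerivAt (fun x : ℝ => x ^ 2 + 4 * T ^ 2) (2 * x) x := by
  simpa using ((hasDerivAt_id x).pow 2).add_const (4 * T ^ 2)

lemma gg_deriv (T x : ℝ) (hT : 0 < T) : HasDerivAt (gg T) (gg1 T x) x := by
  have hS : 0 < x ^ 2 + 4 * T ^ 2 := by positivity
  have hL : 0 < 1 + x ^ 2 / (4 * T ^ 2) := by positivity
  have h1 := (hasDerivAt_const x (2 * T / 3)).fun_div (quad_deriv T x) hS.ne'
  have h2 : HasDerivAt (fun x : ℝ => 1 + x ^ 2 / (4 * T ^ 2)) (2 * x / (4 * T ^ 2)) x := by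
    simpa using (((hasDerivAt_id x).pow 2).div_const (4 * T ^ 2)).const_add 1
  have h3 := (h2.log hL.ne').const_mul (T / 4)
  have h4 : HasDerivAt (fun x : ℝ => (x - 2) / 4) (1 / 4) x := by
    simpa using ((hasDerivAt_id x).sub_const 2).div_const 4
  have h5 := h4.fun_mul (arctan_scaled_deriv T x hT)
  refine ((h1.fun_sub h3).fun_add h5).congr_deriv ?_
  unfold gg1
  generalize Real.arctan (x / (2 * T)) = A
  field_simp
  ring

lemma gg1_deriv (T x : ℝ) (hT : 0 < T) : HasDerivAt (gg1 T) (gg2 T x) x := by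
  have hS : 0 < x ^ 2 + 4 * T ^ 2 := by positivity
  have h1 := (hasDerivAt_const x T).fun_div (quad_deriv T x) hS.ne'
  have h2 := ((hasDerivAt_id x).const_mul (4 * T / 3)).fun_div ((quad_deriv T x).fun_pow 2)
    (pow_pos hS 2).ne'
  refine ((((arctan_scaled_deriv T x hT).div_const 4).fun_sub h1).fun_sub h2).congr_deriv ?_
  unfold gg2
  simp only [id]
  field_simp
  ring

lemma gg2_lower (T x : ℝ) (hT : 0 < T) (hx : 0 ≤ x) :
    T / (2 * (x ^ 2 + 4 * T ^ 2)) - (4 * T / 3) / (x ^ 2 + 4 * T ^ 2) ^ 2 ≤ gg2 T x := by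
  have hS : 0 < x ^ 2 + 4 * T ^ 2 := by positivity
  have h1 : 0 ≤ 2 * T * x / (x ^ 2 + 4 * T ^ 2) ^ 2 := by positivity
  have h2 : (4 * T / 3) * (4 * T ^ 2 - 3 * x ^ 2) / (x ^ 2 + 4 * T ^ 2) ^ 3
      ≤ (4 * T / 3) / (x ^ 2 + 4 * T ^ 2) ^ 2 := by
    rw [div_le_div_iff₀ (by positivity) (by positivity)]
    have : 4 * T ^ 2 - 3 * x ^ 2 ≤ x ^ 2 + 4 * T ^ 2 := by nlinarith [sq_nonneg x]
    calc (4 * T / 3) * (4 * T ^ 2 - 3 * x ^ 2) * (x ^ 2 + 4 * T ^ 2) ^ 2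
        ≤ (4 * T / 3) * (x ^ 2 + 4 * T ^ 2) * (x ^ 2 + 4 * T ^ 2) ^ 2 := by gcongr
      _ = _ := by ring
  unfold gg2
  linarith

lemma gg2_upper (T x m p : ℝ) (hT : 0 < T) (hm : 0 ≤ m) (hmx : m ≤ x) (hxp : x ≤ p) :
    gg2 T x ≤ T / (2 * (m ^ 2 + 4 * T ^ 2)) + (2 * p + 4) * T / (m ^ 2 + 4 * T ^ 2) ^ 2 := by
  have hx : 0 ≤ x := hm.trans hmx
  have hp : 0 ≤ p := hx.trans hxp
  have hS : 0 < x ^ 2 + 4 * T ^ 2 := by positivity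
  have hS' : 0 < m ^ 2 + 4 * T ^ 2 := by positivity
  have hSS : m ^ 2 + 4 * T ^ 2 ≤ x ^ 2 + 4 * T ^ 2 := by gcongr
  have h1 : -((4 * T / 3) * (4 * T ^ 2 - 3 * x ^ 2) / (x ^ 2 + 4 * T ^ 2) ^ 3)
      ≤ 4 * T / (x ^ 2 + 4 * T ^ 2) ^ 2 := by
    rw [← neg_div, div_le_div_iff₀ (by positivity) (by positivity)]
    have : 3 * x ^ 2 - 4 * T ^ 2 ≤ 3 * (x ^ 2 + 4 * T ^ 2) := by nlinarith [sq_nonneg T]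
    calc -((4 * T / 3) * (4 * T ^ 2 - 3 * x ^ 2)) * (x ^ 2 + 4 * T ^ 2) ^ 2
        = (4 * T / 3) * (3 * x ^ 2 - 4 * T ^ 2) * (x ^ 2 + 4 * T ^ 2) ^ 2 := by ring
      _ ≤ (4 * T / 3) * (3 * (x ^ 2 + 4 * T ^ 2)) * (x ^ 2 + 4 * T ^ 2) ^ 2 := by gcongr
      _ = _ := by ring
  have h2 : gg2 T x ≤ T / (2 * (x ^ 2 + 4 * T ^ 2)) + (2 * x + 4) * T / (x ^ 2 + 4 * T ^ 2) ^ 2 := by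
    unfold gg2
    have : (2 * x + 4) * T / (x ^ 2 + 4 * T ^ 2) ^ 2
      = 2 * T * x / (x ^ 2 + 4 * T ^ 2) ^ 2 + 4 * T / (x ^ 2 + 4 * T ^ 2) ^ 2 := by ring
    linarith
  refine h2.trans ?_
  gcongr

/-- second difference bounds -/
lemma gg_second_diff (T u e : ℝ) (hT : 0 < T) (hu : 5 / 4 ≤ u) (he : 0 ≤ e) (he' : e ≤ 5 / 4) :
    gg T (u + e) + gg T (u - e) - 2 * gg T u ≤
      e ^ 2 * (T / (2 * ((u - 5 / 4) ^ 2 + 4 * T ^ 2))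
        + (2 * (u + 5 / 4) + 4) * T / ((u - 5 / 4) ^ 2 + 4 * T ^ 2) ^ 2) := by
  set B := T / (2 * ((u - 5 / 4) ^ 2 + 4 * T ^ 2))
        + (2 * (u + 5 / 4) + 4) * T / ((u - 5 / 4) ^ 2 + 4 * T ^ 2) ^ 2 with hB
  have hlip : ∀ s ∈ Set.Icc (0 : ℝ) (5 / 4), gg1 T (u + s) - gg1 T (u - s) ≤ B * (2 * s) := by
    intro s hs
    have h := Convex.image_sub_le_mul_sub_of_deriv_le (convex_Icc (u - 5 / 4) (u + 5 / 4))
      (f := gg1 T) (C := B)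
      (fun x _ => (gg1_deriv T x hT).continuousAt.continuousWithinAt)
      (fun x _ => (gg1_deriv T x hT).differentiableAt.differentiableWithinAt)
      (fun x hx => by
        rw [interior_Icc] at hx
        rw [(gg1_deriv T x hT).deriv]
        exact gg2_upper T x _ _ hT (by linarith) hx.1.le hx.2.le)
      (u - s) ⟨by linarith [hs.2], by linarith [hs.1]⟩ (u + s) ⟨by linarith [hs.1], by linarith [hs.2]⟩
      (by linarith [hs.1])
    have e1 : u + s - (u - s) = 2 * s := by ring
    rwa [e1] at h
  have hd : ∀ s : ℝ, HasDerivAt (fun s => B * s ^ 2 - (gg T (u + s) + gg T (u - s)))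
      (B * (2 * s) - (gg1 T (u + s) - gg1 T (u - s))) s := by
    intro s
    have h1 : HasDerivAt (fun s => gg T (u + s)) (gg1 T (u + s)) s := by
      simpa using (gg_deriv T (u + s) hT).comp_const_add u s
    have h2 : HasDerivAt (fun s => gg T (u - s)) (-gg1 T (u - s)) s :=
      (gg_deriv T (u - s) hT).comp_const_sub u s
    have h3 : HasDerivAt (fun s : ℝ => B * s ^ 2) (B * (2 * s)) s := by
      simpa using ((hasDerivAt_id s).pow 2).const_mul B
    exact (h3.fun_sub (h1.fun_add h2)).congr_deriv (by ring)
  have hmono : MonotoneOn (fun s => B * s ^ 2 - (gg T (u + s) + gg T (u - s))) (Set.Icc 0 (5 / 4)) := by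
    apply monotoneOn_of_deriv_nonneg (convex_Icc _ _)
    · exact fun x _ => (hd x).continuousAt.continuousWithinAt
    · exact fun x _ => (hd x).differentiableAt.differentiableWithinAt
    · intro x hx
      rw [interior_Icc] at hx
      rw [(hd x).deriv]
      linarith [hlip x ⟨hx.1.le, hx.2.le⟩]
  have := hmono (⟨le_refl _, by norm_num⟩ : (0:ℝ) ∈ Set.Icc (0 : ℝ) (5 / 4)) ⟨he, he'⟩ he
  simp only [add_zero, sub_zero] at this
  linarith

noncomputable def hh (T x : ℝ) : ℝ :=
  ((8 + 6 * Real.pi) / 45) / (x ^ 2 + 4 * T ^ 2) ^ ((3 : ℝ) / 2)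
noncomputable def hh1 (T x : ℝ) : ℝ :=
  ((8 + 6 * Real.pi) / 45) * (-3 * x * (x ^ 2 + 4 * T ^ 2) ^ (-(5 : ℝ) / 2))
noncomputable def hh2 (T x : ℝ) : ℝ :=
  ((8 + 6 * Real.pi) / 45) * (-3 * (x ^ 2 + 4 * T ^ 2) ^ (-(5 : ℝ) / 2)
    + 15 * x ^ 2 * (x ^ 2 + 4 * T ^ 2) ^ (-(7 : ℝ) / 2))

lemma hh_deriv (T x : ℝ) (hT : 0 < T) : HasDerivAt (hh T) (hh1 T x) x := by
  have hS : 0 < x ^ 2 + 4 * T ^ 2 := by positivity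
  have h := ((quad_deriv T x).rpow_const (p := -(3 : ℝ) / 2) (Or.inl hS.ne')).const_mul
    ((8 + 6 * Real.pi) / 45)
  have e : hh T = fun x => ((8 + 6 * Real.pi) / 45) * (x ^ 2 + 4 * T ^ 2) ^ (-(3 : ℝ) / 2) := by
    funext x
    have hS : 0 < x ^ 2 + 4 * T ^ 2 := by positivity
    unfold hh
    rw [neg_div, Real.rpow_neg hS.le, div_eq_mul_inv]
  rw [e]
  refine h.congr_deriv ?_
  unfold hh1
  rw [show (-(3 : ℝ) / 2 - 1) = -5 / 2 by norm_num]
  ring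

lemma hh1_deriv (T x : ℝ) (hT : 0 < T) : HasDerivAt (hh1 T) (hh2 T x) x := by
  have hS : 0 < x ^ 2 + 4 * T ^ 2 := by positivity
  have h0 : HasDerivAt (fun x : ℝ => -3 * x) (-3) x := by
    simpa using (hasDerivAt_id x).const_mul (-3 : ℝ)
  have h := (h0.fun_mul ((quad_deriv T x).rpow_const (p := -(5 : ℝ) / 2) (Or.inl hS.ne'))).const_mul
    ((8 + 6 * Real.pi) / 45)
  refine h.congr_deriv ?_
  unfold hh2
  rw [show (-(5 : ℝ) / 2 - 1) = -7 / 2 by norm_num]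
  ring

lemma const_le : (8 + 6 * Real.pi) / 45 ≤ 0.59666 := by
  have := Real.pi_lt_d4
  linarith

lemma hh2_lower (T x : ℝ) (hT : 0 < T) (hx : 1 ≤ x) :
    -2 / (x ^ 2 + 4 * T ^ 2) ^ 2 ≤ hh2 T x := by
  have hS : 1 ≤ x ^ 2 + 4 * T ^ 2 := by nlinarith [sq_nonneg T]
  have hS0 : 0 < x ^ 2 + 4 * T ^ 2 := by linarith
  have h1 : (x ^ 2 + 4 * T ^ 2) ^ (-(5 : ℝ) / 2) ≤ 1 / (x ^ 2 + 4 * T ^ 2) ^ 2 := by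
    calc (x ^ 2 + 4 * T ^ 2) ^ (-(5 : ℝ) / 2) ≤ (x ^ 2 + 4 * T ^ 2) ^ (-(2 : ℝ)) :=
          Real.rpow_le_rpow_of_exponent_le hS (by norm_num)
      _ = _ := by
        rw [Real.rpow_neg hS0.le, one_div]
        norm_cast
  have h2 : 0 ≤ 15 * x ^ 2 * (x ^ 2 + 4 * T ^ 2) ^ (-(7 : ℝ) / 2) := by positivity
  have h3 := const_le
  have h5 : 0 ≤ (8 + 6 * Real.pi) / 45 := by positivity
  have h4 : 0 ≤ (x ^ 2 + 4 * T ^ 2) ^ (-(5 : ℝ) / 2) := by positivity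
  have e : -2 / (x ^ 2 + 4 * T ^ 2) ^ 2 = -2 * (1 / (x ^ 2 + 4 * T ^ 2) ^ 2) := by ring
  unfold hh2
  rw [e]
  nlinarith [mul_nonneg h5 h2, mul_le_mul_of_nonneg_right h3 h4]

lemma convex_part (T x : ℝ) (hT : 5 / 7 ≤ T) (hx : 8 ≤ x) : 0 ≤ gg2 T x + hh2 T x := by
  have hT0 : 0 < T := by linarith
  have h1 := gg2_lower T x hT0 (by linarith)
  have h2 := hh2_lower T x hT0 (by linarith)
  have hS : 64 ≤ x ^ 2 + 4 * T ^ 2 := by nlinarith [sq_nonneg T]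
  have : 0 ≤ T / (2 * (x ^ 2 + 4 * T ^ 2)) - (4 * T / 3) / (x ^ 2 + 4 * T ^ 2) ^ 2
      + -2 / (x ^ 2 + 4 * T ^ 2) ^ 2 := by
    generalize x ^ 2 + 4 * T ^ 2 = S at *
    have : T / (2 * S) - (4 * T / 3) / S ^ 2 + -2 / S ^ 2
        = (T * S / 2 - 4 * T / 3 - 2) / S ^ 2 := by
      have : S ≠ 0 := by linarith
      field_simp
      ring
    rw [this]
    apply div_nonneg _ (sq_nonneg S)
    nlinarith
  linarith

lemma MM_mono (T u : ℝ) (hT : 5 / 7 ≤ T) (hu : 17 ≤ u) :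
    MonotoneOn (fun s => (gg T (u + s) + hh T (u + s)) + (gg T (u - s) + hh T (u - s)))
      (Set.Icc 0 9) := by
  have hT0 : 0 < T := by linarith
  have hJ : MonotoneOn (fun x => gg1 T x + hh1 T x) (Set.Ici 8) := by
    have hd := fun x => (gg1_deriv T x hT0).fun_add (hh1_deriv T x hT0)
    apply monotoneOn_of_deriv_nonneg (convex_Ici _)
    · exact fun x _ => (hd x).continuousAt.continuousWithinAt
    · exact fun x _ => (hd x).differentiableAt.differentiableWithinAt
    · intro x hx
      rw [interior_Ici] at hx
      rw [(hd x).deriv]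
      exact convex_part T x hT (le_of_lt hx)
  have hM := fun x => (gg_deriv T x hT0).fun_add (hh_deriv T x hT0)
  have hd : ∀ s : ℝ, HasDerivAt
      (fun s => (gg T (u + s) + hh T (u + s)) + (gg T (u - s) + hh T (u - s)))
      ((gg1 T (u + s) + hh1 T (u + s)) + -(gg1 T (u - s) + hh1 T (u - s))) s := by
    intro s
    exact ((hM (u + s)).comp_const_add u s).fun_add ((hM (u - s)).comp_const_sub u s)
  apply monotoneOn_of_deriv_nonneg (convex_Icc _ _)
  · exact fun x _ => (hd x).continuousAt.continuousWithinAt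
  · exact fun x _ => (hd x).differentiableAt.differentiableWithinAt
  · intro x hx
    rw [interior_Icc] at hx
    rw [(hd x).deriv]
    have := hJ (show u - x ∈ Set.Ici 8 by simp only [Set.mem_Ici]; linarith [hx.2])
      (show u + x ∈ Set.Ici 8 by simp only [Set.mem_Ici]; linarith [hx.1]) (by linarith [hx.1])
    simp only at this
    linarith

noncomputable def AA (T y e : ℝ) : ℝ :=
  2 * Real.arctan (y / (2 * T)) - Real.arctan ((y + e) / (2 * T)) - Real.arctan ((y - e) / (2 * T))

lemma AA_mono (T y : ℝ) (hT : 0 < T) (hy : 0 ≤ y) : MonotoneOn (AA T y) (Set.Ici 0) := by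
  have hd : ∀ s : ℝ, HasDerivAt (AA T y)
      (0 - (2 * T / ((y + s) ^ 2 + 4 * T ^ 2)) - -(2 * T / ((y - s) ^ 2 + 4 * T ^ 2))) s := by
    intro s
    exact ((hasDerivAt_const s _).fun_sub
      ((arctan_scaled_deriv T (y + s) hT).comp_const_add y s)).fun_sub
      ((arctan_scaled_deriv T (y - s) hT).comp_const_sub y s)
  apply monotoneOn_of_deriv_nonneg (convex_Ici _)
  · exact fun x _ => (hd x).continuousAt.continuousWithinAt
  · exact fun x _ => (hd x).differentiableAt.differentiableWithinAt
  · intro x hx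
    rw [interior_Ici] at hx
    have hx0 : 0 < x := hx
    rw [(hd x).deriv]
    have : 2 * T / ((y + x) ^ 2 + 4 * T ^ 2) ≤ 2 * T / ((y - x) ^ 2 + 4 * T ^ 2) := by
      apply div_le_div_of_nonneg_left (by positivity) (by positivity)
      nlinarith [mul_nonneg hy hx0.le]
    linarith

lemma my_arctan_le {x : ℝ} (hx : 0 ≤ x) : Real.arctan x ≤ x := by
  rcases hx.eq_or_lt with rfl | h
  · simp
  · have := Real.le_tan (Real.arctan_nonneg.2 hx) (Real.arctan_lt_pi_div_two x)
    rwa [Real.tan_arctan] at this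

lemma arctan_sub_aux (N P Q : ℝ) (hP : 0 < P) (hQ : 0 < Q) :
    Real.arctan (N / P) - Real.arctan (N / Q)
      = Real.arctan (N * (Q - P) / (P * Q + N ^ 2)) := by
  have e : 1 - N / P * -(N / Q) = (P * Q + N ^ 2) / (P * Q) := by
    field_simp
    ring
  have h3 : 0 < P * Q + N ^ 2 := by positivity
  have h4 : 0 < (P * Q + N ^ 2) / (P * Q) := by positivity
  rw [sub_eq_add_neg, ← Real.arctan_neg, Real.arctan_add (by linarith), e]
  congr 1
  field_simp
  ring

lemma AA_le (T y d : ℝ) (hT : 0 < T) (hy : 0 ≤ y) (hd : 0 ≤ d) (h : d < 2 * T) :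
    AA T y (2 * d) ≤ 16 * d ^ 2 * T * y /
      ((4 * T ^ 2 + y ^ 2) ^ 2 + d ^ 2 * (16 * T ^ 2 - 4 * y ^ 2)) := by
  have hα : 0 < 4 * T ^ 2 + y ^ 2 - 2 * d * y := by nlinarith [sq_nonneg (y - d), sq_nonneg (y-2*T)]
  have hβ : 0 < 4 * T ^ 2 + y ^ 2 + 2 * d * y := by positivity
  have h1 : Real.arctan (y / (2 * T)) - Real.arctan ((y - 2 * d) / (2 * T))
      = Real.arctan (4 * d * T / (4 * T ^ 2 + y ^ 2 - 2 * d * y)) := by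
    rw [sub_eq_add_neg, ← Real.arctan_neg, Real.arctan_add]
    · congr 1
      have : 1 - y / (2 * T) * -((y - 2 * d) / (2 * T)) = (4 * T ^ 2 + y ^ 2 - 2 * d * y) / (4 * T ^ 2) := by
        field_simp
        ring
      rw [this]
      field_simp
      ring
    · have : 1 - y / (2 * T) * -((y - 2 * d) / (2 * T)) = (4 * T ^ 2 + y ^ 2 - 2 * d * y) / (4 * T ^ 2) := by
        field_simp
        ring
      have h3 : 0 < (4 * T ^ 2 + y ^ 2 - 2 * d * y) / (4 * T ^ 2) := by positivity
      linarith
  have h2 : Real.arctan ((y + 2 * d) / (2 * T)) - Real.arctan (y / (2 * T))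
      = Real.arctan (4 * d * T / (4 * T ^ 2 + y ^ 2 + 2 * d * y)) := by
    have e : 1 - (y + 2 * d) / (2 * T) * -(y / (2 * T)) = (4 * T ^ 2 + y ^ 2 + 2 * d * y) / (4 * T ^ 2) := by
        field_simp
        ring
    rw [sub_eq_add_neg, ← Real.arctan_neg, Real.arctan_add]
    · congr 1
      rw [e]
      field_simp
      ring
    · have h3 : 0 < (4 * T ^ 2 + y ^ 2 + 2 * d * y) / (4 * T ^ 2) := by positivity
      linarith
  have hP : 0 < (4 * T ^ 2 + y ^ 2) ^ 2 + d ^ 2 * (16 * T ^ 2 - 4 * y ^ 2) := by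
    nlinarith [mul_pos hα hβ, sq_nonneg (d * T)]
  have h3 : AA T y (2 * d) = Real.arctan (16 * d ^ 2 * T * y /
      ((4 * T ^ 2 + y ^ 2) ^ 2 + d ^ 2 * (16 * T ^ 2 - 4 * y ^ 2))) := by
    have : AA T y (2 * d) = (Real.arctan (y / (2 * T)) - Real.arctan ((y - 2 * d) / (2 * T)))
      - (Real.arctan ((y + 2 * d) / (2 * T)) - Real.arctan (y / (2 * T))) := by
      unfold AA; ring
    rw [this, h1, h2, arctan_sub_aux _ _ _ hα hβ]
    congr 1
    congr 1 <;> ring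
  rw [h3]
  exact my_arctan_le (by positivity)

noncomputable def F0 (q T : ℝ) : ℝ :=
  16 * T / ((4*T^2+1)^2 + q * (16*T^2-4)) + 80 * T / ((4*T^2+25)^2-625/16)
    + 144 * T / ((4*T^2+81)^2-2025/16) + 208 * T / ((4*T^2+169)^2-4225/16)
    + 4 * (T / (2 * ((63/4)^2+4*T^2)) + 81 / 2 * T / ((63/4)^2+4*T^2)^2)

noncomputable def F1 (q T : ℝ) : ℝ :=
  48 * T / ((4*T^2+9)^2 + q * (16*T^2-36)) + 112 * T / ((4*T^2+49)^2-1225/16)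
    + 176 * T / ((4*T^2+121)^2-3025/16) + 240 * T / ((4*T^2+225)^2-5625/16)
    + 4 * (T / (2 * ((71/4)^2+4*T^2)) + 89 / 2 * T / ((71/4)^2+4*T^2)^2)

lemma frac_aux (T R L Dl k dd c a0 a1 a2 a3 b D0 D1 D2 D3 S : ℝ) (h0 : 0 < D0) (h1 : 0 < D1)
    (h2 : 0 < D2) (h3 : 0 < D3) (h4 : 0 < S) (h5 : 0 < Dl)
    (hN : 0 ≤ (R * k - c) * (D0 * D1 * D2 * D3 * S ^ 2 * Dl) + R * L * (D0 * D1 * D2 * D3 * S ^ 2)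
      - dd * (a0 * (D1 * D2 * D3 * S ^ 2 * Dl) + a1 * (D0 * D2 * D3 * S ^ 2 * Dl)
        + a2 * (D0 * D1 * D3 * S ^ 2 * Dl) + a3 * (D0 * D1 * D2 * S ^ 2 * Dl)
        + 4 * (T * S / 2 + b * T) * (D0 * D1 * D2 * D3 * Dl))) :
    dd * (a0 / D0 + a1 / D1 + a2 / D2 + a3 / D3 + 4 * (T / (2 * S) + b * T / S ^ 2)) + c
      ≤ R * (L / Dl + k) := by
  rw [← sub_nonneg]
  have h := div_nonneg hN (show 0 ≤ D0 * D1 * D2 * D3 * S ^ 2 * Dl by positivity)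
  refine h.trans_eq ?_
  field_simp
  ring

lemma u01 (T : ℝ) (h : 5/7 ≤ T) :
    1/16 * F0 (1/16) T + 62/100000 ≤ 31415/10000 * ((1/32) / (3*T-1) + 1/1024) := by
  have hd0 : 0 < (4*T^2+1)^2 + 1/16 * (16*T^2-4) := by nlinarith [sq_nonneg (T^2), sq_nonneg T]
  have hd1 : 0 < (4*T^2+25)^2-625/16 := by nlinarith [sq_nonneg (T^2), sq_nonneg T]
  have hd2 : 0 < (4*T^2+81)^2-2025/16 := by nlinarith [sq_nonneg (T^2), sq_nonneg T]
  have hd3 : 0 < (4*T^2+169)^2-4225/16 := by nlinarith [sq_nonneg (T^2), sq_nonneg T]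
  have hd4 : 0 < (63/4)^2+4*T^2 := by positivity
  have hd5 : 0 < 3*T-1 := by linarith
  have hN : 0 ≤ 101212821866684387328443690625 * T^0 + 1429245505277465650940039428125 * T^1 - 2997048346393831670151764666100 * T^2 + 976406155784499383155495518300 * T^3 + 166075912735361951839038309312 * T^4 + 642601823153176935747143273664 * T^5 - 30530076650753239568539763712 * T^6 + 174112810669856557343045569536 * T^7 - 2170051151666056843790204928 * T^8 + 25223727693859434091655184384 * T^9 - 454647666355440370679808000 * T^10 + 2068317387720623646081024000 * T^11 - 38098723541917483709497344 * T^12 + 100018934162893434710392832 * T^13 - 1603934630070653030498304 * T^14 + 2886432089800166407667712 * T^15 - 29941388964153593430016 * T^16 + 48642261893502361141248 * T^17 - 183994240756753629184 * T^18 + 440444194555640676352 * T^19 + 444506162830770176 * T^20 + 1653634701849526272 * T^21 := by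
    rcases le_total T 16 with h' | h
    · have hx : 0 ≤ T - 5/7 := by linarith
      have hy : 0 ≤ 16 - T := by linarith
      have key : (101212821866684387328443690625 * T^0 + 1429245505277465650940039428125 * T^1 - 2997048346393831670151764666100 * T^2 + 976406155784499383155495518300 * T^3 + 166075912735361951839038309312 * T^4 + 642601823153176935747143273664 * T^5 - 30530076650753239568539763712 * T^6 + 174112810669856557343045569536 * T^7 - 2170051151666056843790204928 * T^8 + 25223727693859434091655184384 * T^9 - 454647666355440370679808000 * T^10 + 2068317387720623646081024000 * T^11 - 38098723541917483709497344 * T^12 + 100018934162893434710392832 * T^13 - 1603934630070653030498304 * T^14 + 2886432089800166407667712 * T^15 - 29941388964153593430016 * T^16 + 48642261893502361141248 * T^17 - 183994240756753629184 * T^18 + 440444194555640676352 * T^19 + 444506162830770176 * T^20 + 1653634701849526272 * T^21) * 4140562374860211619063098135818149338786107 = 69882020082516153832592876954237137259622195000 * ((T - 5/7)^0*(16 - T)^21) + 296439345004640590834509852448835962215463504875 * ((T - 5/7)^1*(16 - T)^20) + 329058423347007737284939377992648974933443435241700 * ((T - 5/7)^2*(16 - T)^19) + 18997321662664522665868944728265597171135606021664390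 * ((T - 5/7)^3*(16 - T)^18) + 439713127365645496384228875066938876912778013622754404 * ((T - 5/7)^4*(16 - T)^17) + 6412432588247821457198108087828443364853612813718259611 * ((T - 5/7)^5*(16 - T)^16) + 69464991632889006860894457818109921515715666651074485648 * ((T - 5/7)^6*(16 - T)^15) + 604384959449063568186684119641560038403399294495241142952 * ((T - 5/7)^7*(16 - T)^14) + 4355447811869824133449754055541760248637506197480918798432 * ((T - 5/7)^8*(16 - T)^13) + 26409551669330341832566972817232637440053277124638073962934 * ((T - 5/7)^9*(16 - T)^12) + 135701071959105429656947680788814889064047031328757262365624 * ((T - 5/7)^10*(16 - T)^11) + 594549104560800698479365655893414445764527400029699896499908 * ((T - 5/7)^11*(16 - T)^10) + 2225383036179310825225553568854495694475217024187020841663896 * ((T - 5/7)^12*(16 - T)^9) + 7123235452404160246710673106888596251894430537974177404120686 * ((T - 5/7)^13*(16 - T)^8) + 19428944342199367057865340754793575314491751202379933510422352 * ((T - 5/7)^14*(16 - T)^7) + 44932949862273360562724905709291795242870515398993291319070568 * ((T - 5/7)^15*(16 - T)^6) + 87079378866504363908927881637739196899587842824805281102348552 * ((T - 5/7)^16*(16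 - T)^5) + 139267638628776384422134609948981535043433408439458896489872895 * ((T - 5/7)^17*(16 - T)^4) + 178298690412091874789066334295206525041467135171071252061741700 * ((T - 5/7)^18*(16 - T)^3) + 175075286885912067688983630236841605523215559475654143131848358 * ((T - 5/7)^19*(16 - T)^2) + 119040679356010814508388149818828054519209163089856003336311140 * ((T - 5/7)^20*(16 - T)^1) + 46039499764046168004802776506821042159364134730718353513484375 * ((T - 5/7)^21*(16 - T)^0) := by ring
      generalize T - 5/7 = x at hx key
      generalize 16 - T = y at hy key
      have h2 : 0 ≤ (101212821866684387328443690625 * T^0 + 1429245505277465650940039428125 * T^1 - 2997048346393831670151764666100 * T^2 + 976406155784499383155495518300 * T^3 + 166075912735361951839038309312 * T^4 + 642601823153176935747143273664 * T^5 - 30530076650753239568539763712 * T^6 + 174112810669856557343045569536 * T^7 - 2170051151666056843790204928 * T^8 + 25223727693859434091655184384 * T^9 - 454647666355440370679808000 * T^10 + 2068317387720623646081024000 * T^11 - 38098723541917483709497344 * T^12 + 100018934162893434710392832 * T^13 - 1603934630070653030498304 * T^14 + 2886432089800166407667712 * T^15 - 29941388964153593430016 * T^16 + 48642261893502361141248 *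 T^17 - 183994240756753629184 * T^18 + 440444194555640676352 * T^19 + 444506162830770176 * T^20 + 1653634701849526272 * T^21) * 4140562374860211619063098135818149338786107 := by rw [key]; positivity
      exact nonneg_of_mul_nonneg_left h2 (by norm_num)
    · obtain ⟨x, hx, rfl⟩ : ∃ x : ℝ, 0 ≤ x ∧ T = x + 16 := ⟨T - 16, by linarith, by ring⟩
      have key : 101212821866684387328443690625 * (x + 16)^0 + 1429245505277465650940039428125 * (x + 16)^1 - 2997048346393831670151764666100 * (x + 16)^2 + 976406155784499383155495518300 * (x + 16)^3 + 166075912735361951839038309312 * (x + 16)^4 + 642601823153176935747143273664 * (x + 16)^5 - 30530076650753239568539763712 * (x + 16)^6 + 174112810669856557343045569536 * (x + 16)^7 - 2170051151666056843790204928 * (x + 16)^8 + 25223727693859434091655184384 * (x + 16)^9 - 454647666355440370679808000 * (x + 16)^10 + 2068317387720623646081024000 * (x + 16)^11 - 38098723541917483709497344 * (x + 16)^12 + 100018934162893434710392832 * (x + 16)^13 - 1603934630070653030498304 * (x + 16)^14 + 2886432089800166407667712 * (x + 16)^15 - 29941388964153593430016 * (x + 16)^16 + 48642261893502361141248 * (x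 + 16)^17 - 183994240756753629184 * (x + 16)^18 + 440444194555640676352 * (x + 16)^19 + 444506162830770176 * (x + 16)^20 + 1653634701849526272 * (x + 16)^21 = (82427429374324901275787615193394463100140625 * x^0 + 99298595306936650649439759965638466572168605 * x^1 + 57181734582442866370264946184634709072685644 * x^2 + 20935097293925995216797696963106029495660636 * x^3 + 5467063536895872364275670942864188997992384 * x^4 + 1082910578074204183908239589008569534614720 * x^5 + 168898949308822727585318381545550246607872 * x^6 + 21252331582804754449850785530515158977536 * x^7 + 2192644806696157223007878167220349222912 * x^8 + 187477112834292369886167219935248105472 * x^9 + 13371626595769622226684935169831600128 * x^10 + 798062121870432647717196598034563072 * x^11 + 39859312849034360722318696447475712 * x^12 + 1660930787182336505028601171673088 * x^13 + 57373693282102609702146835218432 * x^14 + 1625647849222429341336536612864 * x^15 + 37179653938814523659647975424 * x^16 + 669962165703548959318867968 * x^17 + 9163804513235873954791424 * x^18 + 89482087738092019515392 * x^19 + 556065765984271597568 * x^20 + 1653634701849526272 * x^21) / 1 := by ring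
      rw [key]; positivity
  unfold F0
  refine frac_aux _ _ _ _ _ _ _ _ _ _ _ _ _ _ _ _ _ hd0 hd1 hd2 hd3 hd4 hd5 ?_
  have hN2 := mul_nonneg (show (0:ℝ) ≤ 1/214748364800000 by norm_num) hN
  refine hN2.trans_eq ?_
  ring

lemma u02 (T : ℝ) (h : 5/7 ≤ T) :
    1/4 * F0 (1/16) T + 62/100000 ≤ 31415/10000 * ((13/96) / (3*T-1) + 1/1024) := by
  have hd0 : 0 < (4*T^2+1)^2 + 1/16 * (16*T^2-4) := by nlinarith [sq_nonneg (T^2), sq_nonneg T]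
  have hd1 : 0 < (4*T^2+25)^2-625/16 := by nlinarith [sq_nonneg (T^2), sq_nonneg T]
  have hd2 : 0 < (4*T^2+81)^2-2025/16 := by nlinarith [sq_nonneg (T^2), sq_nonneg T]
  have hd3 : 0 < (4*T^2+169)^2-4225/16 := by nlinarith [sq_nonneg (T^2), sq_nonneg T]
  have hd4 : 0 < (63/4)^2+4*T^2 := by positivity
  have hd5 : 0 < 3*T-1 := by linarith
  have hN : 0 ≤ 1341649005404129383862006071875 * T^0 + 17081063796259060470081430284375 * T^1 - 34373085829012835629874291598300 * T^2 + 10841803201709154341734774554900 * T^3 + 5513457705248631637714711599936 * T^4 + 5775476871598112889727701820992 * T^5 + 1205836702682359528456617636864 * T^6 + 1224893202279193126665578308608 * T^7 + 265305510381821027044583817216 * T^8 + 142490352114578950035247153152 * T^9 + 21942078591262913128267776000 * T^10 + 9755315496862244280041472000 * T^11 + 981063421534158565794643968 * T^12 + 409417775821525418294378496 * T^13 + 24514340192613513547481088 * T^14 + 10575237041626191690203136 * T^15 + 405068119473835791613952 * T^16 + 163427162504003787423744 * T^17 + 4886224878454018408448 * T^18 + 1384664453426819629056 * T^19 + 32401319042930966528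 * T^20 + 4960904105548578816 * T^21 := by
    obtain ⟨x, hx, rfl⟩ : ∃ x : ℝ, 0 ≤ x ∧ T = x + 5/7 := ⟨T - 5/7, by linarith, by ring⟩
    have key : 1341649005404129383862006071875 * (x + 5/7)^0 + 17081063796259060470081430284375 * (x + 5/7)^1 - 34373085829012835629874291598300 * (x + 5/7)^2 + 10841803201709154341734774554900 * (x + 5/7)^3 + 5513457705248631637714711599936 * (x + 5/7)^4 + 5775476871598112889727701820992 * (x + 5/7)^5 + 1205836702682359528456617636864 * (x + 5/7)^6 + 1224893202279193126665578308608 * (x + 5/7)^7 + 265305510381821027044583817216 * (x + 5/7)^8 + 142490352114578950035247153152 * (x + 5/7)^9 + 21942078591262913128267776000 * (x + 5/7)^10 + 9755315496862244280041472000 * (x + 5/7)^11 + 981063421534158565794643968 * (x + 5/7)^12 + 409417775821525418294378496 * (x + 5/7)^13 + 24514340192613513547481088 * (x + 5/7)^14 + 10575237041626191690203136 * (x + 5/7)^15 + 405068119473835791613952 * (x + 5/7)^16 + 163427162504003787423744 * (x + 5/7)^17 + 4886224878454018408448 * (x + 5/7)^18 + 1384664453426819629056 * (x + 5/7)^19 +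 32401319042930966528 * (x + 5/7)^20 + 4960904105548578816 * (x + 5/7)^21 = (1545784251608474084473691508245951790615171585000 * x^0 + 1626671426795162909896293242555650969745359342125 * x^1 + 21138273336671789149531824652830861937788129122600 * x^2 + 45094553368346576327143016648647040345303560827020 * x^3 + 33585536027810007332442952945752979501090250820352 * x^4 + 20048862054435921485755153123977159102521551894464 * x^5 + 9894384235351802389137031869930132639426449020928 * x^6 + 4136796959352111386674817174049262719909947063296 * x^7 + 1403547263224671878457449131216470502504020836352 * x^8 + 415950727932142003378051163489319791698866520064 * x^9 + 104640809455756359111414895376866936315484569600 * x^10 + 23507439407743497387156386307817215425864007680 * x^11 + 4509399964718636664281940424822236316608495616 * x^12 + 792067004727953354262803308183222184818245632 * x^13 + 117421586380979010786820685353683900816162816 * x^14 + 16490339104675007403978308630417997574438912 * x^15 + 1854133242395737771477789784738537305800704 * x^16 + 205681702694060823065225845899173956681728 * x^17 + 16322700606877572283742644127127574675456 * x^18 + 1328817407451571239961878274586225672192 * x^19 + 59661009796291173288832340123111653376 * x^20 + 2770892470267942121007653600951795712 * x^21) / 558545864083284007 := by ring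
    rw [key]; positivity
  unfold F0
  refine frac_aux _ _ _ _ _ _ _ _ _ _ _ _ _ _ _ _ _ hd0 hd1 hd2 hd3 hd4 hd5 ?_
  have hN2 := mul_nonneg (show (0:ℝ) ≤ 1/644245094400000 by norm_num) hN
  refine hN2.trans_eq ?_
  ring

lemma u03 (T : ℝ) (h : 5/7 ≤ T) :
    25/64 * F0 (1/4) T + 62/100000 ≤ 31415/10000 * ((3/16) / (3*T-1) + 1/1024) := by
  have hd0 : 0 < (4*T^2+1)^2 + 1/4 * (16*T^2-4) := by nlinarith [sq_nonneg (T^2), sq_nonneg T]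
  have hd1 : 0 < (4*T^2+25)^2-625/16 := by nlinarith [sq_nonneg (T^2), sq_nonneg T]
  have hd2 : 0 < (4*T^2+81)^2-2025/16 := by nlinarith [sq_nonneg (T^2), sq_nonneg T]
  have hd3 : 0 < (4*T^2+169)^2-4225/16 := by nlinarith [sq_nonneg (T^2), sq_nonneg T]
  have hd4 : 0 < (63/4)^2+4*T^2 := by positivity
  have hd5 : 0 < 3*T-1 := by linarith
  have hN : 0 ≤ 550697936126094870750000000000 * T^1 - 1031875716609562113983218809375 * T^2 + 368355863888343110558471428125 * T^3 + 68981457964820935663075833900 * T^4 + 185723598695392222465581618300 * T^5 - 19013957349655559208772716288 * T^6 + 37157240750887298600890078464 * T^7 - 2522263335604207887034967040 * T^8 + 4057939209706021774008069120 * T^9 - 343566386898479080511569920 * T^10 + 260563266702243220605173760 * T^11 - 23704269752794858009657344 * T^12 + 10284398028915893299576832 * T^13 - 894809583401948996960256 * T^14 + 250938102637731898195968 * T^15 - 16360998755754785636352 * T^16 + 3683754583085291667456 * T^17 - 114997336028517236736 * T^18 + 29856115109719441408 * T^19 + 9089937504731136 * T^20 + 103352168865595392 * T^21 := by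
    rcases le_total T 64 with h' | h
    · have hx : 0 ≤ T - 5/7 := by linarith
      have hy : 0 ≤ 64 - T := by linarith
      have key : (550697936126094870750000000000 * T^1 - 1031875716609562113983218809375 * T^2 + 368355863888343110558471428125 * T^3 + 68981457964820935663075833900 * T^4 + 185723598695392222465581618300 * T^5 - 19013957349655559208772716288 * T^6 + 37157240750887298600890078464 * T^7 - 2522263335604207887034967040 * T^8 + 4057939209706021774008069120 * T^9 - 343566386898479080511569920 * T^10 + 260563266702243220605173760 * T^11 - 23704269752794858009657344 * T^12 + 10284398028915893299576832 * T^13 - 894809583401948996960256 * T^14 + 250938102637731898195968 * T^15 - 16360998755754785636352 * T^16 + 3683754583085291667456 * T^17 - 114997336028517236736 * T^18 + 29856115109719441408 * T^19 + 9089937504731136 * T^20 + 103352168865595392 * T^21) * 37538615479419666209332877237998976945484704534779050443 = 30517384363450376906713915195407114172401375000 * ((T - 5/7)^0*(64 - T)^21) + 517260165345744339306195814655922177756165271875 * ((T - 5/7)^1*(64 - T)^20) + 1615472337630400173333231353837183655025167917523750 * ((T - 5/7)^2*(64 - T)^19) + 275670318193762446614931429169110981409345455425806375 * ((T - 5/7)^3*(64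 - T)^18) + 14612684414488035023214925073291004607098436608219266800 * ((T - 5/7)^4*(64 - T)^17) + 538316501329197123800604488342660144265902057269387945340 * ((T - 5/7)^5*(64 - T)^16) + 16073805391916292709137190908648399661372627654497557207464 * ((T - 5/7)^6*(64 - T)^15) + 420206476049371440572279920873919874435926445589008534851612 * ((T - 5/7)^7*(64 - T)^14) + 8852843227620544042109209548546896788894889744492168369906368 * ((T - 5/7)^8*(64 - T)^13) + 162860193141322391324211962309405339517986836003767000989495722 * ((T - 5/7)^9*(64 - T)^12) + 2475409253166443355275682672497244635400067152937688161508555748 * ((T - 5/7)^10*(64 - T)^11) + 34288829645915960283103639929819871370430040655791653564369815154 * ((T - 5/7)^11*(64 - T)^10) + 394243265645962403411298420283325925653259025334965046524094927696 * ((T - 5/7)^12*(64 - T)^9) + 4334463133487311831813110552671110820818372531903139261788236447980 * ((T - 5/7)^13*(64 - T)^8) + 39399200897516457682868934096663857220968682095654392669771659027112 * ((T - 5/7)^14*(64 - T)^7) + 366146474116528647518824720422746632021503794791880446914648334540652 * ((T - 5/7)^15*(64 - T)^6) + 2692065622582062707781680822369956549888145511655640885330113603593832 * ((T - 5/7)^16*(64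 - T)^5) + 20729012162385770323357308812642946628358082766296431904686165976037547 * ((T - 5/7)^17*(64 - T)^4) + 112680416463627963335335196610281939537711208161711352903446156058801062 * ((T - 5/7)^18*(64 - T)^3) + 620653952575611257383884500887808455461278951594694438665404035804002271 * ((T - 5/7)^19*(64 - T)^2) + 1899633788174758811097479438993904284443400183334494414901083966611635840 * ((T - 5/7)^20*(64 - T)^1) + 5252989912071687022198770272763413529354556255755156539938790840373964800 * ((T - 5/7)^21*(64 - T)^0) := by ring
      generalize T - 5/7 = x at hx key
      generalize 64 - T = y at hy key
      have h2 : 0 ≤ (550697936126094870750000000000 * T^1 - 1031875716609562113983218809375 * T^2 + 368355863888343110558471428125 * T^3 + 68981457964820935663075833900 * T^4 + 185723598695392222465581618300 * T^5 - 19013957349655559208772716288 * T^6 + 37157240750887298600890078464 * T^7 - 2522263335604207887034967040 * T^8 + 4057939209706021774008069120 * T^9 - 343566386898479080511569920 * T^10 + 260563266702243220605173760 * T^11 - 23704269752794858009657344 * T^12 + 10284398028915893299576832 * T^13 - 894809583401948996960256 * T^14 + 250938102637731898195968 * T^15 - 16360998755754785636352 * T^16 + 3683754583085291667456 * T^17 -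 114997336028517236736 * T^18 + 29856115109719441408 * T^19 + 9089937504731136 * T^20 + 103352168865595392 * T^21) * 37538615479419666209332877237998976945484704534779050443 := by rw [key]; positivity
      exact nonneg_of_mul_nonneg_left h2 (by norm_num)
    · obtain ⟨x, hx, rfl⟩ : ∃ x : ℝ, 0 ≤ x ∧ T = x + 64 := ⟨T - 64, by linarith, by ring⟩
      have key : 550697936126094870750000000000 * (x + 64)^1 - 1031875716609562113983218809375 * (x + 64)^2 + 368355863888343110558471428125 * (x + 64)^3 + 68981457964820935663075833900 * (x + 64)^4 + 185723598695392222465581618300 * (x + 64)^5 - 19013957349655559208772716288 * (x + 64)^6 + 37157240750887298600890078464 * (x + 64)^7 - 2522263335604207887034967040 * (x + 64)^8 + 4057939209706021774008069120 * (x + 64)^9 - 343566386898479080511569920 * (x + 64)^10 + 260563266702243220605173760 * (x + 64)^11 - 23704269752794858009657344 * (x + 64)^12 + 10284398028915893299576832 * (x + 64)^13 - 894809583401948996960256 * (x + 64)^14 + 250938102637731898195968 * (x + 64)^15 - 16360998755754785636352 * (x + 64)^16 + 3683754583085291667456 * (x + 64)^17 - 114997336028517236736 * (x + 64)^18 + 29856115109719441408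 * (x + 64)^19 + 9089937504731136 * (x + 64)^20 + 103352168865595392 * (x + 64)^21 = (9404760199403107401612341865100230046954847097073766400 * x^0 + 3067025976024133120226544716557078967365547983864302720 * x^1 + 476417292251886672587639304550152408957898249286785953 * x^2 + 46882493365373419027093546309497508889512994798945309 * x^3 + 3278959145559215211226084179676659572426728920797996 * x^4 + 173320874936511442250506313303657627561201551348860 * x^5 + 7187534616840804445775019577789594713125278349568 * x^6 + 239584749654568178212259182718673289781659636992 * x^7 + 6523943169796080354368272528749161105249639424 * x^8 + 146673693334257288654829735780115651648367616 * x^9 + 2740339044500318074189404979140884962803712 * x^10 + 42678200583310865680345378472236905725952 * x^11 + 554062841628502311101099317692354265088 * x^12 + 5977590193493574727173346662758481920 * x^13 + 53246524616711467057400077898219520 * x^14 + 387469842539477664847356613361664 * x^15 + 2266455475941851740175868100608 * x^16 + 10401259924124735986301140992 * x^17 + 36077154961887581408591872 * x^18 + 88940892806546307678208 * x^19 + 138914404892864937984 * x^20 + 103352168865595392 * x^21) / 1 := by ring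
      rw [key]; positivity
  unfold F0
  refine frac_aux _ _ _ _ _ _ _ _ _ _ _ _ _ _ _ _ _ hd0 hd1 hd2 hd3 hd4 hd5 ?_
  have hN2 := mul_nonneg (show (0:ℝ) ≤ 1/13421772800000 by norm_num) hN
  refine hN2.trans_eq ?_
  ring

lemma u11 (T : ℝ) (h : 5/7 ≤ T) (h' : T ≤ 3/2) :
    1/16 * F1 (25/64) T + 43/100000 ≤ 31415/10000 * ((21/512) / (3*T+2) + 1/1024) := by
  have hd0 : 0 < (4*T^2+9)^2 + 25/64 * (16*T^2-36) := by nlinarith [sq_nonneg (T^2), sq_nonneg T]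
  have hd1 : 0 < (4*T^2+49)^2-1225/16 := by nlinarith [sq_nonneg (T^2), sq_nonneg T]
  have hd2 : 0 < (4*T^2+121)^2-3025/16 := by nlinarith [sq_nonneg (T^2), sq_nonneg T]
  have hd3 : 0 < (4*T^2+225)^2-5625/16 := by nlinarith [sq_nonneg (T^2), sq_nonneg T]
  have hd4 : 0 < (71/4)^2+4*T^2 := by positivity
  have hd5 : 0 < 3*T+2 := by linarith
  have hN : 0 ≤ 1292853571863608422237634086522500 * T^0 - 876017046580582625638474724544375 * T^1 + 466645854330751148074120615916400 * T^2 - 262927767832487772540836202792900 * T^3 + 240887733767005815055801774522368 * T^4 - 22773506201655741641230442754048 * T^5 + 42342564709679077115485138759680 * T^6 + 1896260154763027791126425963520 * T^7 + 4007512188090142985815282679808 * T^8 + 457019386793257754159965274112 * T^9 + 216079083436382088957562716160 * T^10 + 33644203186745045508445962240 * T^11 + 7026938137000401723109408768 * T^12 + 1292505495097109629791895552 * T^13 + 140288187293715271820247040 * T^14 + 28601129645750134306242560 * T^15 + 1704799821641136700653568 * T^16 + 365859383514921017802752 * T^17 + 11782014314224518430720 * T^18 + 2509209832999962542080 * T^19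 + 36367763259667775488 * T^20 + 7127949164918341632 * T^21 := by
    have hx : 0 ≤ T - 5/7 := by linarith
    have hy : 0 ≤ 3/2 - T := by linarith
    have key : (1292853571863608422237634086522500 * T^0 - 876017046580582625638474724544375 * T^1 + 466645854330751148074120615916400 * T^2 - 262927767832487772540836202792900 * T^3 + 240887733767005815055801774522368 * T^4 - 22773506201655741641230442754048 * T^5 + 42342564709679077115485138759680 * T^6 + 1896260154763027791126425963520 * T^7 + 4007512188090142985815282679808 * T^8 + 457019386793257754159965274112 * T^9 + 216079083436382088957562716160 * T^10 + 33644203186745045508445962240 * T^11 + 7026938137000401723109408768 * T^12 + 1292505495097109629791895552 * T^13 + 140288187293715271820247040 * T^14 + 28601129645750134306242560 * T^15 + 1704799821641136700653568 * T^16 + 365859383514921017802752 * T^17 + 11782014314224518430720 * T^18 + 2509209832999962542080 * T^19 + 36367763259667775488 * T^20 + 7127949164918341632 * T^21) * 7400249944258160101211 = 1023728199824533777554062657085999244373353184652165120000 * ((T - 5/7)^0*(3/2 - T)^21) + 21279366029433719009505541665730038884822995949973012480000 * ((T - 5/7)^1*(3/2 - T)^20) + 211145022407517992104821036199275480944206695575764126924800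 * ((T - 5/7)^2*(3/2 - T)^19) + 1330623460381646598580868138789700201232789639093761558446080 * ((T - 5/7)^3*(3/2 - T)^18) + 5977154810273280834008516132452394866301551150022868170964992 * ((T - 5/7)^4*(3/2 - T)^17) + 20359187016357772008933305628850855738435391446221036344836096 * ((T - 5/7)^5*(3/2 - T)^16) + 54608317043287412765229155014045637491962272980685179137818624 * ((T - 5/7)^6*(3/2 - T)^15) + 118225014393624278759484628334634640531186014723559198063329280 * ((T - 5/7)^7*(3/2 - T)^14) + 210046259073549996971627340716820350876316328991849025195999232 * ((T - 5/7)^8*(3/2 - T)^13) + 309647071134776311472204476211126637808898421472834127128428544 * ((T - 5/7)^9*(3/2 - T)^12) + 381364998831081451212447422440132347972661526568746783592153088 * ((T - 5/7)^10*(3/2 - T)^11) + 393740449649277388389746568404000902831233689006202979138666496 * ((T - 5/7)^11*(3/2 - T)^10) + 340863668942863542084830614078956387343970528977396391888289792 * ((T - 5/7)^12*(3/2 - T)^9) + 246709712940732035401389687534463699230476233495945980269297664 * ((T - 5/7)^13*(3/2 - T)^8) + 148334629714026209220068219299851390229048046902610609244733440 * ((T - 5/7)^14*(3/2 - T)^7)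 + 73303583867283802544895966082901802038628809499259896890130432 * ((T - 5/7)^15*(3/2 - T)^6) + 29293270132435960161062023534206326561451130144749379330768896 * ((T - 5/7)^16*(3/2 - T)^5) + 9237465071728245737728195545390215647185733236784050585206784 * ((T - 5/7)^17*(3/2 - T)^4) + 2213813682417622398090664896875964720996125030617716055080960 * ((T - 5/7)^18*(3/2 - T)^3) + 379056592054337592071202473567875183532222588238527122636800 * ((T - 5/7)^19*(3/2 - T)^2) + 41317257262888123666270362308671778481266806938803109888000 * ((T - 5/7)^20*(3/2 - T)^1) + 2154745560454072920946284524136028187852548901909299200000 * ((T - 5/7)^21*(3/2 - T)^0) := by ring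
    generalize T - 5/7 = x at hx key
    generalize 3/2 - T = y at hy key
    have h2 : 0 ≤ (1292853571863608422237634086522500 * T^0 - 876017046580582625638474724544375 * T^1 + 466645854330751148074120615916400 * T^2 - 262927767832487772540836202792900 * T^3 + 240887733767005815055801774522368 * T^4 - 22773506201655741641230442754048 * T^5 + 42342564709679077115485138759680 * T^6 + 1896260154763027791126425963520 * T^7 + 4007512188090142985815282679808 * T^8 + 457019386793257754159965274112 * T^9 + 216079083436382088957562716160 * T^10 + 33644203186745045508445962240 * T^11 + 7026938137000401723109408768 * T^12 + 1292505495097109629791895552 * T^13 + 140288187293715271820247040 * T^14 + 28601129645750134306242560 * T^15 + 1704799821641136700653568 * T^16 + 365859383514921017802752 * T^17 + 11782014314224518430720 * T^18 + 2509209832999962542080 * T^19 + 36367763259667775488 * T^20 + 7127949164918341632 * T^21) * 7400249944258160101211 := by rw [key]; positivity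
    exact nonneg_of_mul_nonneg_left h2 (by norm_num)
  unfold F1
  refine frac_aux _ _ _ _ _ _ _ _ _ _ _ _ _ _ _ _ _ hd0 hd1 hd2 hd3 hd4 hd5 ?_
  have hN2 := mul_nonneg (show (0:ℝ) ≤ 1/858993459200000 by norm_num) hN
  refine hN2.trans_eq ?_
  ring

lemma u12 (T : ℝ) (h : 5/7 ≤ T) (h' : T ≤ 3/2) :
    25/64 * F1 (25/64) T + 43/100000 ≤ 31415/10000 * ((1/4) / (3*T+2) + 1/1024) := by
  have hd0 : 0 < (4*T^2+9)^2 + 25/64 * (16*T^2-36) := by nlinarith [sq_nonneg (T^2), sq_nonneg T]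
  have hd1 : 0 < (4*T^2+49)^2-1225/16 := by nlinarith [sq_nonneg (T^2), sq_nonneg T]
  have hd2 : 0 < (4*T^2+121)^2-3025/16 := by nlinarith [sq_nonneg (T^2), sq_nonneg T]
  have hd3 : 0 < (4*T^2+225)^2-5625/16 := by nlinarith [sq_nonneg (T^2), sq_nonneg T]
  have hd4 : 0 < (71/4)^2+4*T^2 := by positivity
  have hd5 : 0 < 3*T+2 := by linarith
  have hN : 0 ≤ 7621140833595919828391718078303750 * T^0 - 5875576027881838120476493028544375 * T^1 + 2243440621747857851724591017231400 * T^2 - 2230314934869681608508790122792900 * T^3 + 1220340462461914042476137095815168 * T^4 - 391068180101874991577702916354048 * T^5 + 212227452528453832264253666887680 * T^6 - 33858985832432982441418854036480 * T^7 + 19995139788517414125327360196608 * T^8 - 1549384036162942250521762725888 * T^9 + 1070138546271637665569673052160 * T^10 - 34225870118673878575982837760 * T^11 + 34535116007708387228744941568 * T^12 - 105101602145443473363304448 * T^13 + 685145170687031942095831040 * T^14 + 11611188406397059003842560 * T^15 + 8325357680821074151866368 * T^16 + 254908544765347078602752 * T^17 + 58193621061592646942720 * T^18 + 2213661107453773742080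 * T^19 + 184389296246686220288 * T^20 + 7127949164918341632 * T^21 := by
    have hx : 0 ≤ T - 5/7 := by linarith
    have hy : 0 ≤ 3/2 - T := by linarith
    have key : (7621140833595919828391718078303750 * T^0 - 5875576027881838120476493028544375 * T^1 + 2243440621747857851724591017231400 * T^2 - 2230314934869681608508790122792900 * T^3 + 1220340462461914042476137095815168 * T^4 - 391068180101874991577702916354048 * T^5 + 212227452528453832264253666887680 * T^6 - 33858985832432982441418854036480 * T^7 + 19995139788517414125327360196608 * T^8 - 1549384036162942250521762725888 * T^9 + 1070138546271637665569673052160 * T^10 - 34225870118673878575982837760 * T^11 + 34535116007708387228744941568 * T^12 - 105101602145443473363304448 * T^13 + 685145170687031942095831040 * T^14 + 11611188406397059003842560 * T^15 + 8325357680821074151866368 * T^16 + 254908544765347078602752 * T^17 + 58193621061592646942720 * T^18 + 2213661107453773742080 * T^19 + 184389296246686220288 * T^20 + 7127949164918341632 * T^21) * 7400249944258160101211 = 4717468967969843891922889903879124952111882068781957120000 * ((T - 5/7)^0*(3/2 - T)^21) + 94838344464799142662060198114680787079763854703783444480000 * ((T - 5/7)^1*(3/2 - T)^20) + 906491452224695024242941672845302715046134186461247360204800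 * ((T - 5/7)^2*(3/2 - T)^19) + 5478685057462680356792311785141129316102236499641862670254080 * ((T - 5/7)^3*(3/2 - T)^18) + 23488566998577520587433845226353853867622480422288527764488192 * ((T - 5/7)^4*(3/2 - T)^17) + 75961237192084618346885338234931967711944165551841010826346496 * ((T - 5/7)^5*(3/2 - T)^16) + 192365871836542279985882392897498055150612828446087199089229824 * ((T - 5/7)^6*(3/2 - T)^15) + 390884586194733828065313733374260948949001322619692256099041280 * ((T - 5/7)^7*(3/2 - T)^14) + 647829234380337358528935975680737412789007730295455174132498432 * ((T - 5/7)^8*(3/2 - T)^13) + 885356577029662551683662920856309145686237631169807329729183744 * ((T - 5/7)^9*(3/2 - T)^12) + 1004709719994993498395878750794702957382615551317901407198117888 * ((T - 5/7)^10*(3/2 - T)^11) + 950280010852226141142200142998121581191037112081893304404279296 * ((T - 5/7)^11*(3/2 - T)^10) + 749795438153268155458340507934601935814365225850426812889300992 * ((T - 5/7)^12*(3/2 - T)^9) + 492602976325598033115267322690517800769384808025757980362276864 * ((T - 5/7)^13*(3/2 - T)^8) + 268144738439746860310575730832507154547582605854456997677629440 * ((T - 5/7)^14*(3/2 - T)^7)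 + 119889135741953610537895907919027395946459395138212410930757632 * ((T - 5/7)^15*(3/2 - T)^6) + 43422018184383742183404885556781125156901179589778463361335296 * ((T - 5/7)^16*(3/2 - T)^5) + 12466945142900639674097015589095150414904134079438706241961984 * ((T - 5/7)^17*(3/2 - T)^4) + 2740980814485687158319659805429596536136632759639910079528960 * ((T - 5/7)^18*(3/2 - T)^3) + 435125465375065074390581003776862898054612414212493724876800 * ((T - 5/7)^19*(3/2 - T)^2) + 44555483442405484574346343735534291138090039441261068288000 * ((T - 5/7)^20*(3/2 - T)^1) + 2215860508205822366373591210505662280012259418911539200000 * ((T - 5/7)^21*(3/2 - T)^0) := by ring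
    generalize T - 5/7 = x at hx key
    generalize 3/2 - T = y at hy key
    have h2 : 0 ≤ (7621140833595919828391718078303750 * T^0 - 5875576027881838120476493028544375 * T^1 + 2243440621747857851724591017231400 * T^2 - 2230314934869681608508790122792900 * T^3 + 1220340462461914042476137095815168 * T^4 - 391068180101874991577702916354048 * T^5 + 212227452528453832264253666887680 * T^6 - 33858985832432982441418854036480 * T^7 + 19995139788517414125327360196608 * T^8 - 1549384036162942250521762725888 * T^9 + 1070138546271637665569673052160 * T^10 - 34225870118673878575982837760 * T^11 + 34535116007708387228744941568 * T^12 - 105101602145443473363304448 * T^13 + 685145170687031942095831040 * T^14 + 11611188406397059003842560 * T^15 + 8325357680821074151866368 * T^16 + 254908544765347078602752 * T^17 + 58193621061592646942720 * T^18 + 2213661107453773742080 * T^19 + 184389296246686220288 * T^20 + 7127949164918341632 * T^21) * 7400249944258160101211 := by rw [key]; positivity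
    exact nonneg_of_mul_nonneg_left h2 (by norm_num)
  unfold F1
  refine frac_aux _ _ _ _ _ _ _ _ _ _ _ _ _ _ _ _ _ hd0 hd1 hd2 hd3 hd4 hd5 ?_
  have hN2 := mul_nonneg (show (0:ℝ) ≤ 1/858993459200000 by norm_num) hN
  refine hN2.trans_eq ?_
  ring

lemma u13 (T : ℝ) (h : 3/2 ≤ T) :
    1/16 * F1 (1/16) T + 43/100000 ≤ 31415/10000 * ((21/512) / (3*T+2) + 1/1024) := by
  have hd0 : 0 < (4*T^2+9)^2 + 1/16 * (16*T^2-36) := by nlinarith [sq_nonneg (T^2), sq_nonneg T]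
  have hd1 : 0 < (4*T^2+49)^2-1225/16 := by nlinarith [sq_nonneg (T^2), sq_nonneg T]
  have hd2 : 0 < (4*T^2+121)^2-3025/16 := by nlinarith [sq_nonneg (T^2), sq_nonneg T]
  have hd3 : 0 < (4*T^2+225)^2-5625/16 := by nlinarith [sq_nonneg (T^2), sq_nonneg T]
  have hd4 : 0 < (71/4)^2+4*T^2 := by positivity
  have hd5 : 0 < 3*T+2 := by linarith
  have hN : 0 ≤ 380251050548120124187539437212500 * T^0 - 219534133722984439073407389571875 * T^1 + 102398543879985681322771342566000 * T^2 - 65162626455137661518776746538500 * T^3 + 56298396352566306200497346200320 * T^4 - 5772315285608510235442479923520 * T^5 + 10190081678745677602927374544896 * T^6 + 448598745569407275181981830144 * T^7 + 980890935804494761263280619520 * T^8 + 112076967518651942663344865280 * T^9 + 53361587652143933047979376640 * T^10 + 8319493497838447163595816960 * T^11 + 1744115716560778373588058112 * T^12 + 320978595264167637856288768 * T^13 + 34924550757727691018862592 * T^14 + 7121694608613074416959488 * T^15 + 425213203086189134872576 * T^16 + 91263187487164322545664 * T^17 + 2942520285476234985472 * T^18 + 626717743670055927808 * T^19 + 9091940814916943872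 * T^20 + 1781987291229585408 * T^21 := by
    obtain ⟨x, hx, rfl⟩ : ∃ x : ℝ, 0 ≤ x ∧ T = x + 3/2 := ⟨T - 3/2, by linarith, by ring⟩
    have key : 380251050548120124187539437212500 * (x + 3/2)^0 - 219534133722984439073407389571875 * (x + 3/2)^1 + 102398543879985681322771342566000 * (x + 3/2)^2 - 65162626455137661518776746538500 * (x + 3/2)^3 + 56298396352566306200497346200320 * (x + 3/2)^4 - 5772315285608510235442479923520 * (x + 3/2)^5 + 10190081678745677602927374544896 * (x + 3/2)^6 + 448598745569407275181981830144 * (x + 3/2)^7 + 980890935804494761263280619520 * (x + 3/2)^8 + 112076967518651942663344865280 * (x + 3/2)^9 + 53361587652143933047979376640 * (x + 3/2)^10 + 8319493497838447163595816960 * (x + 3/2)^11 + 1744115716560778373588058112 * (x + 3/2)^12 + 320978595264167637856288768 * (x + 3/2)^13 + 34924550757727691018862592 * (x + 3/2)^14 + 7121694608613074416959488 * (x + 3/2)^15 + 425213203086189134872576 * (x + 3/2)^16 + 91263187487164322545664 * (x + 3/2)^17 + 2942520285476234985472 * (x + 3/2)^18 + 626717743670055927808 * (x + 3/2)^19 +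 9091940814916943872 * (x + 3/2)^20 + 1781987291229585408 * (x + 3/2)^21 = (459882892242004164697102323825000 * x^0 + 949985265543870018995194261866750 * x^1 + 1690021677055101611576478430697550 * x^2 + 1600647449569854845145170027628060 * x^3 + 1073255098418638390954657508553504 * x^4 + 548260322314700316340561690201536 * x^5 + 226518161303095395901203662212608 * x^6 + 77095428869003478807758037076992 * x^7 + 22252260688340341968379815075840 * x^8 + 5484854101680431284025690603520 * x^9 + 1173633448416126270389506146304 * x^10 + 218041710894716822728186527744 * x^11 + 35507788065323204793704906752 * x^12 + 5046627881710718675530547200 * x^13 + 627896297860941149894606848 * x^14 + 67826533883566113010221056 * x^15 + 6313356528795384052449280 * x^16 + 500814673668640537051136 * x^17 + 32689676131956623933440 * x^18 + 1741464963223543349248 * x^19 + 65224540488648884224 * x^20 + 1781987291229585408 * x^21) / 1 := by ring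
    rw [key]; positivity
  unfold F1
  refine frac_aux _ _ _ _ _ _ _ _ _ _ _ _ _ _ _ _ _ hd0 hd1 hd2 hd3 hd4 hd5 ?_
  have hN2 := mul_nonneg (show (0:ℝ) ≤ 1/214748364800000 by norm_num) hN
  refine hN2.trans_eq ?_
  ring

lemma u14 (T : ℝ) (h : 3/2 ≤ T) :
    25/64 * F1 (1/16) T + 43/100000 ≤ 31415/10000 * ((1/4) / (3*T+2) + 1/1024) := by
  have hd0 : 0 < (4*T^2+9)^2 + 1/16 * (16*T^2-36) := by nlinarith [sq_nonneg (T^2), sq_nonneg T]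
  have hd1 : 0 < (4*T^2+49)^2-1225/16 := by nlinarith [sq_nonneg (T^2), sq_nonneg T]
  have hd2 : 0 < (4*T^2+121)^2-3025/16 := by nlinarith [sq_nonneg (T^2), sq_nonneg T]
  have hd3 : 0 < (4*T^2+225)^2-5625/16 := by nlinarith [sq_nonneg (T^2), sq_nonneg T]
  have hd4 : 0 < (71/4)^2+4*T^2 := by positivity
  have hd5 : 0 < 3*T+2 := by linarith
  have hN : 0 ≤ 2241512009881152890703446493618750 * T^0 - 1489873478931357658984097949571875 * T^1 + 474707574379386392894586778041000 * T^2 - 551412309327772187088749994538500 * T^3 + 282524557883719267820189761672320 * T^4 - 96549717800105738187468899123520 * T^5 + 50856655126340691874021577066496 * T^6 - 8386661903460271125302165369856 * T^7 + 4885577976103237732374405611520 * T^8 - 385292429614296910302031134720 * T^9 + 264084170940709975673879920640 * T^10 - 8550332624551609881600983040 * T^11 + 8569307093310599539365773312 * T^12 - 27144323683502820511711232 * T^13 + 170546607465268950484385792 * T^14 + 2882992150412840023359488 * T^15 + 2076413971946078707122176 * T^16 + 63549722031163298545664 * T^17 + 14533279580940425756672 * T^18 + 552830562283508727808 * T^19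 + 46097324061671555072 * T^20 + 1781987291229585408 * T^21 := by
    rcases le_total T 64 with h' | h
    · have hx : 0 ≤ T - 3/2 := by linarith
      have hy : 0 ≤ 64 - T := by linarith
      have key : (2241512009881152890703446493618750 * T^0 - 1489873478931357658984097949571875 * T^1 + 474707574379386392894586778041000 * T^2 - 551412309327772187088749994538500 * T^3 + 282524557883719267820189761672320 * T^4 - 96549717800105738187468899123520 * T^5 + 50856655126340691874021577066496 * T^6 - 8386661903460271125302165369856 * T^7 + 4885577976103237732374405611520 * T^8 - 385292429614296910302031134720 * T^9 + 264084170940709975673879920640 * T^10 - 8550332624551609881600983040 * T^11 + 8569307093310599539365773312 * T^12 - 27144323683502820511711232 * T^13 + 170546607465268950484385792 * T^14 + 2882992150412840023359488 * T^15 + 2076413971946078707122176 * T^16 + 63549722031163298545664 * T^17 + 14533279580940425756672 * T^18 + 552830562283508727808 * T^19 + 46097324061671555072 * T^20 + 1781987291229585408 * T^21) * 34694469519536141888238489627838134765625 = 317375621333100545242157592449384448 * ((T - 3/2)^0*(64 - T)^21) + 3108154031621643230948194522736099328 * ((T - 3/2)^1*(64 - T)^20) + 7114484633642866537799684175579426324480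 * ((T - 3/2)^2*(64 - T)^19) + 660970529963828160134687497373399793008640 * ((T - 3/2)^3*(64 - T)^18) + 34736158929631492910144863830356792919982080 * ((T - 3/2)^4*(64 - T)^17) + 1285014337941657342170150970478096911540682752 * ((T - 3/2)^5*(64 - T)^16) + 36998178437771156343179656521169778949281021952 * ((T - 3/2)^6*(64 - T)^15) + 857985709392968901050863138624993857005829488640 * ((T - 3/2)^7*(64 - T)^14) + 16551607906974784802140278060402406695128971345920 * ((T - 3/2)^8*(64 - T)^13) + 269134018350416148446548815110869523348611179479040 * ((T - 3/2)^9*(64 - T)^12) + 3748968784575251902221148642005044352379250139987968 * ((T - 3/2)^10*(64 - T)^11) + 44904873663454149566860146655465108760717093962252288 * ((T - 3/2)^11*(64 - T)^10) + 466352797616675615252148880157132487883017885413539840 * ((T - 3/2)^12*(64 - T)^9) + 4187618630256256822156996458814493833935745456191569920 * ((T - 3/2)^13*(64 - T)^8) + 32597108797301143844606756293172832179467473311330467840 * ((T - 3/2)^14*(64 - T)^7) + 217595699019543864830642745309750050201926868063561449472 * ((T - 3/2)^15*(64 - T)^6) + 1239987550555461290861948196813322875420842423615626412032 * ((T - 3/2)^16*(64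 - T)^5) + 5880580398282417084140414661308877249145915613866549575680 * ((T - 3/2)^17*(64 - T)^4) + 22775126375463033905669777011809637856431976515637362032640 * ((T - 3/2)^18*(64 - T)^3) + 67431361182313671159712757672428010397178226316410754170880 * ((T - 3/2)^19*(64 - T)^2) + 141715843689343763000816110433681548224703258032173831159808 * ((T - 3/2)^20*(64 - T)^1) + 154055358529167384865969648309413310592547906874574653882368 * ((T - 3/2)^21*(64 - T)^0) := by ring
      generalize T - 3/2 = x at hx key
      generalize 64 - T = y at hy key
      have h2 : 0 ≤ (2241512009881152890703446493618750 * T^0 - 1489873478931357658984097949571875 * T^1 + 474707574379386392894586778041000 * T^2 - 551412309327772187088749994538500 * T^3 + 282524557883719267820189761672320 * T^4 - 96549717800105738187468899123520 * T^5 + 50856655126340691874021577066496 * T^6 - 8386661903460271125302165369856 * T^7 + 4885577976103237732374405611520 * T^8 - 385292429614296910302031134720 * T^9 + 264084170940709975673879920640 * T^10 - 8550332624551609881600983040 * T^11 + 8569307093310599539365773312 * T^12 - 27144323683502820511711232 * T^13 + 170546607465268950484385792 * T^14 + 2882992150412840023359488 * T^15 + 2076413971946078707122176 * T^16 + 63549722031163298545664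 * T^17 + 14533279580940425756672 * T^18 + 552830562283508727808 * T^19 + 46097324061671555072 * T^20 + 1781987291229585408 * T^21) * 34694469519536141888238489627838134765625 := by rw [key]; positivity
      exact nonneg_of_mul_nonneg_left h2 (by norm_num)
    · obtain ⟨x, hx, rfl⟩ : ∃ x : ℝ, 0 ≤ x ∧ T = x + 64 := ⟨T - 64, by linarith, by ring⟩
      have key : 2241512009881152890703446493618750 * (x + 64)^0 - 1489873478931357658984097949571875 * (x + 64)^1 + 474707574379386392894586778041000 * (x + 64)^2 - 551412309327772187088749994538500 * (x + 64)^3 + 282524557883719267820189761672320 * (x + 64)^4 - 96549717800105738187468899123520 * (x + 64)^5 + 50856655126340691874021577066496 * (x + 64)^6 - 8386661903460271125302165369856 * (x + 64)^7 + 4885577976103237732374405611520 * (x + 64)^8 - 385292429614296910302031134720 * (x + 64)^9 + 264084170940709975673879920640 * (x + 64)^10 - 8550332624551609881600983040 * (x + 64)^11 + 8569307093310599539365773312 * (x + 64)^12 - 27144323683502820511711232 * (x + 64)^13 + 170546607465268950484385792 * (x + 64)^14 + 2882992150412840023359488 * (x + 64)^15 + 2076413971946078707122176 * (x + 64)^16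 + 63549722031163298545664 * (x + 64)^17 + 14533279580940425756672 * (x + 64)^18 + 552830562283508727808 * (x + 64)^19 + 46097324061671555072 * (x + 64)^20 + 1781987291229585408 * (x + 64)^21 = (229560373021911658146932197078188226509910683146975418750 * x^0 + 73753516326503069858182585336303662639112538965556476125 * x^1 + 11285682593734965985487753560629116924414891628011173800 * x^2 + 1093908918938634055296102562792263986115021065921432060 * x^3 + 75350776372952196696971771994909728915428550344344704 * x^4 + 3922209925882176455771868796562321345581658969439936 * x^5 + 160151428105411994135924956656510844250419048286208 * x^6 + 5255561678797915050766499742715373660172787387392 * x^7 + 140868140139596822428402358121273717121496023040 * x^8 + 3116923804876110284856193974849037890569093120 * x^9 + 57302459225331010847167285328011311386722304 * x^10 + 877987768840925061512501274743016443346944 * x^11 + 11211602853694506255391801635058013437952 * x^12 + 118951058797965715476151042464599244800 * x^13 + 1041761062486305489407825238502146048 * x^14 + 7451511100789415523635802937491456 * x^15 + 42832317177330337297491013140480 * x^16 + 193112195726238419637329985536 * x^17 + 657854134428950579527024640 * x^18 + 1592351593785263283765248 * x^19 + 2441088243474234343424 * x^20 + 1781987291229585408 * x^21) / 1 := by ri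ng
      rw [key]; positivity
  unfold F1
  refine frac_aux _ _ _ _ _ _ _ _ _ _ _ _ _ _ _ _ _ hd0 hd1 hd2 hd3 hd4 hd5 ?_
  have hN2 := mul_nonneg (show (0:ℝ) ≤ 1/214748364800000 by norm_num) hN
  refine hN2.trans_eq ?_
  ring


lemma Efun_eq (a T d : ℝ) : Efun a T d =
    ((gg T (2 * a + 17 + 2 * d) + hh T (2 * a + 17 + 2 * d))
      + (gg T (2 * a + 17 - 2 * d) + hh T (2 * a + 17 - 2 * d)))
    - 2 * gg T (2 * a + 17) + 2 * hh T (2 * a + 17)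
    + (AA T (2 * a + 1) (2 * d) + AA T (2 * a + 5) (2 * d) + AA T (2 * a + 9) (2 * d)
      + AA T (2 * a + 13) (2 * d)) := by
  unfold Efun gg hh AA
  simp only [Finset.sum_range_succ, Finset.sum_range_zero, Nat.cast_zero, Nat.cast_one,
    Nat.cast_ofNat]
  have e1 : 2 * a + 2 * d + 17 = 2 * a + 17 + 2 * d := by ring
  have e2 : 2 * a - 2 * d + 17 = 2 * a + 17 - 2 * d := by ring
  have a0 : 2 * a + 1 + 4 * (0 : ℝ) = 2 * a + 1 := by ring
  have a1 : 2 * a + 1 + 4 * (1 : ℝ) = 2 * a + 5 := by ring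
  have a2 : 2 * a + 1 + 4 * (2 : ℝ) = 2 * a + 9 := by ring
  have a3 : 2 * a + 1 + 4 * (3 : ℝ) = 2 * a + 13 := by ring
  have b0 : 2 * a + 2 * d + 1 + 4 * (0 : ℝ) = 2 * a + 1 + 2 * d := by ring
  have b1 : 2 * a + 2 * d + 1 + 4 * (1 : ℝ) = 2 * a + 5 + 2 * d := by ring
  have b2 : 2 * a + 2 * d + 1 + 4 * (2 : ℝ) = 2 * a + 9 + 2 * d := by ring
  have b3 : 2 * a + 2 * d + 1 + 4 * (3 : ℝ) = 2 * a + 13 + 2 * d := by ring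
  have c0 : 2 * a - 2 * d + 1 + 4 * (0 : ℝ) = 2 * a + 1 - 2 * d := by ring
  have c1 : 2 * a - 2 * d + 1 + 4 * (1 : ℝ) = 2 * a + 5 - 2 * d := by ring
  have c2 : 2 * a - 2 * d + 1 + 4 * (2 : ℝ) = 2 * a + 9 - 2 * d := by ring
  have c3 : 2 * a - 2 * d + 1 + 4 * (3 : ℝ) = 2 * a + 13 - 2 * d := by ring
  rw [e1, e2, a0, a1, a2, a3, b0, b1, b2, b3, c0, c1, c2, c3]
  ring

lemma Efun_mono (a T d₁ d₂ : ℝ) (ha : 0 ≤ a) (hT : 5 / 7 ≤ T) (h0 : 0 ≤ d₁) (h12 : d₁ ≤ d₂)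
    (h2 : d₂ ≤ 9 / 2) : Efun a T d₁ ≤ Efun a T d₂ := by
  have hT0 : 0 < T := by linarith
  have hM := MM_mono T (2 * a + 17) hT (by linarith)
    (show 2 * d₁ ∈ Set.Icc (0 : ℝ) 9 from ⟨by linarith, by linarith⟩)
    (show 2 * d₂ ∈ Set.Icc (0 : ℝ) 9 from ⟨by linarith, by linarith⟩) (by linarith)
  have hA : ∀ y : ℝ, 0 ≤ y → AA T y (2 * d₁) ≤ AA T y (2 * d₂) := fun y hy =>
    AA_mono T y hT0 hy (show 2 * d₁ ∈ Set.Ici (0 : ℝ) by simp only [Set.mem_Ici]; linarith)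
      (show 2 * d₂ ∈ Set.Ici (0 : ℝ) by simp only [Set.mem_Ici]; linarith) (by linarith)
  simp only at hM
  rw [Efun_eq, Efun_eq]
  linarith [hA (2 * a + 1) (by linarith), hA (2 * a + 5) (by linarith),
    hA (2 * a + 9) (by linarith), hA (2 * a + 13) (by linarith)]

lemma hh_pos (T x : ℝ) (hT : 0 < T) : 0 < hh T x := by
  unfold hh
  positivity

lemma Efun_pos (a T d : ℝ) (ha : 0 ≤ a) (hT : 5 / 7 ≤ T) (h0 : 0 ≤ d) (h2 : d ≤ 9 / 2) :
    0 < Efun a T d := by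
  refine lt_of_lt_of_le ?_ (Efun_mono a T 0 d ha hT le_rfl h0 h2)
  rw [Efun_eq]
  have := hh_pos T (2 * a + 17) (by linarith)
  simp only [AA, mul_zero, add_zero, sub_zero]
  linarith

lemma hh_le (T x m : ℝ) (hm : 0 < m) (hmx : m ≤ x) : hh T x ≤ 0.59666 / m ^ 3 := by
  unfold hh
  have h1 : m ^ 3 ≤ (x ^ 2 + 4 * T ^ 2) ^ ((3 : ℝ) / 2) := by
    have : m ^ 3 = (m ^ 2) ^ ((3 : ℝ) / 2) := by
      rw [← Real.rpow_natCast m 2, ← Real.rpow_mul hm.le, ← Real.rpow_natCast m 3]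
      norm_num
    rw [this]
    apply Real.rpow_le_rpow (by positivity) _ (by norm_num)
    nlinarith [sq_nonneg T]
  have := const_le
  gcongr

lemma AA_le' (T y d D : ℝ) (hT : 0 < T) (hy : 0 ≤ y) (hd : 0 ≤ d) (h : d < 2 * T) (hD : 0 < D)
    (hD' : D ≤ (4 * T ^ 2 + y ^ 2) ^ 2 + d ^ 2 * (16 * T ^ 2 - 4 * y ^ 2)) :
    AA T y (2 * d) ≤ d ^ 2 * (16 * y * T / D) := by
  refine (AA_le T y d hT hy hd h).trans ?_
  have : d ^ 2 * (16 * y * T / D) = 16 * d ^ 2 * T * y / D := by ring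
  rw [this]
  gcongr

lemma AA_le_far (T y d : ℝ) (hT : 0 < T) (hy : 5 ≤ y) (hd : 0 ≤ d) (hd' : d ≤ 5 / 8)
    (h : d < 2 * T) :
    AA T y (2 * d) ≤ d ^ 2 * (16 * y * T / ((4 * T ^ 2 + y ^ 2) ^ 2 - 25 * y ^ 2 / 16)) := by
  have hq : d ^ 2 ≤ 25 / 64 := by nlinarith
  apply AA_le' T y d _ hT (by linarith) hd h
  · have hy2 : 25 ≤ y ^ 2 := by nlinarith
    have hS : y ^ 2 ≤ 4 * T ^ 2 + y ^ 2 := by nlinarith [sq_nonneg T]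
    nlinarith [mul_self_le_mul_self (sq_nonneg y) hS, mul_nonneg (sub_nonneg.2 hy2) (sq_nonneg y)]
  · nlinarith [mul_nonneg (sub_nonneg.2 hq) (sq_nonneg y), sq_nonneg (d * T)]

lemma Efun0_le (T d q : ℝ) (hT : 5 / 7 ≤ T) (hd : 1 / 4 ≤ d) (hd' : d ≤ 5 / 8) (hq : 0 ≤ q)
    (hqd : q * (16 * T ^ 2 - 4) ≤ d ^ 2 * (16 * T ^ 2 - 4)) :
    Efun 0 T d ≤ d ^ 2 * F0 q T + 62 / 100000 := by
  have hT0 : 0 < T := by linarith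
  have h1 := gg_second_diff T 17 (2 * d) hT0 (by norm_num) (by linarith) (by linarith)
  have k1 := hh_le T (17 + 2 * d) (63 / 4) (by norm_num) (by linarith)
  have k2 := hh_le T (17 - 2 * d) (63 / 4) (by norm_num) (by linarith)
  have k3 := hh_le T 17 (63 / 4) (by norm_num) (by norm_num)
  have hD0 : 0 < (4 * T ^ 2 + 1) ^ 2 + q * (16 * T ^ 2 - 4) := by
    have : 0 ≤ q * (16 * T ^ 2 - 4) := mul_nonneg hq (by nlinarith)
    positivity
  have a0 := AA_le' T 1 d _ hT0 (by norm_num) (by linarith) (by linarith) hD0 (by nlinarith)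
  have a1 := AA_le_far T 5 d hT0 (by norm_num) (by linarith) hd' (by linarith)
  have a2 := AA_le_far T 9 d hT0 (by norm_num) (by linarith) hd' (by linarith)
  have a3 := AA_le_far T 13 d hT0 (by norm_num) (by linarith) hd' (by linarith)
  rw [Efun_eq]
  unfold F0
  norm_num at h1 k1 k2 k3 a0 a1 a2 a3 ⊢
  linarith

lemma Efun1_le (T d q : ℝ) (hT : 5 / 7 ≤ T) (hd : 1 / 4 ≤ d) (hd' : d ≤ 5 / 8) (hq : 0 ≤ q)
    (hq' : q ≤ 1) (hqd : q * (16 * T ^ 2 - 36) ≤ d ^ 2 * (16 * T ^ 2 - 36)) :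
    Efun 1 T d ≤ d ^ 2 * F1 q T + 43 / 100000 := by
  have hT0 : 0 < T := by linarith
  have h1 := gg_second_diff T 19 (2 * d) hT0 (by norm_num) (by linarith) (by linarith)
  have k1 := hh_le T (19 + 2 * d) (71 / 4) (by norm_num) (by linarith)
  have k2 := hh_le T (19 - 2 * d) (71 / 4) (by norm_num) (by linarith)
  have k3 := hh_le T 19 (71 / 4) (by norm_num) (by norm_num)
  have hD0 : 0 < (4 * T ^ 2 + 9) ^ 2 + q * (16 * T ^ 2 - 36) := by
    nlinarith [mul_nonneg hq (sq_nonneg T), sq_nonneg (T ^ 2), sq_nonneg T]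
  have a0 := AA_le' T 3 d _ hT0 (by norm_num) (by linarith) (by linarith) hD0 (by nlinarith)
  have a1 := AA_le_far T 7 d hT0 (by norm_num) (by linarith) hd' (by linarith)
  have a2 := AA_le_far T 11 d hT0 (by norm_num) (by linarith) hd' (by linarith)
  have a3 := AA_le_far T 15 d hT0 (by norm_num) (by linarith) hd' (by linarith)
  rw [Efun_eq]
  unfold F1
  norm_num at h1 k1 k2 k3 a0 a1 a2 a3 ⊢
  linarith

lemma F0_nonneg (q T : ℝ) (hT : 5 / 7 ≤ T) (hq : 0 ≤ q) : 0 ≤ F0 q T := by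
  have hT0 : 0 < T := by linarith
  have h0 : 0 ≤ q * (16*T^2-4) := mul_nonneg hq (by nlinarith)
  have h1 : 0 ≤ (4*T^2+25)^2-625/16 := by nlinarith [sq_nonneg (T^2), sq_nonneg T]
  have h2 : 0 ≤ (4*T^2+81)^2-2025/16 := by nlinarith [sq_nonneg (T^2), sq_nonneg T]
  have h3 : 0 ≤ (4*T^2+169)^2-4225/16 := by nlinarith [sq_nonneg (T^2), sq_nonneg T]
  unfold F0
  positivity

lemma F1_nonneg (q T : ℝ) (hT : 5 / 7 ≤ T) (hq : 0 ≤ q) (hq' : q ≤ 1) : 0 ≤ F1 q T := by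
  have hT0 : 0 < T := by linarith
  have h0 : 0 ≤ (4*T^2+9)^2 + q * (16*T^2-36) := by
    nlinarith [mul_nonneg hq (sq_nonneg T), sq_nonneg (T ^ 2), sq_nonneg T]
  have h1 : 0 ≤ (4*T^2+49)^2-1225/16 := by nlinarith [sq_nonneg (T^2), sq_nonneg T]
  have h2 : 0 ≤ (4*T^2+121)^2-3025/16 := by nlinarith [sq_nonneg (T^2), sq_nonneg T]
  have h3 : 0 ≤ (4*T^2+225)^2-5625/16 := by nlinarith [sq_nonneg (T^2), sq_nonneg T]
  unfold F1
  positivity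

/-- Chord argument in `d`, together with the replacement of `3.1415` by `π`. -/
lemma chord_aux (F E c α β D d d₁ d₂ : ℝ) (hF : 0 ≤ F) (hd₁ : d₁ ≤ d) (hd₂ : d ≤ d₂)
    (h12 : d₁ < d₂) (hD : 0 < D) (hpos : 0 ≤ α * d - β)
    (h1 : d₁ ^ 2 * F + c ≤ 31415 / 10000 * ((α * d₁ - β) / 1536 / D + 1 / 1024))
    (h2 : d₂ ^ 2 * F + c ≤ 31415 / 10000 * ((α * d₂ - β) / 1536 / D + 1 / 1024))
    (hE : E ≤ d ^ 2 * F + c) :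
    E / Real.pi ≤ (α * d - β) / (1536 * D) + 1 / 1024 := by
  have hpi := Real.pi_gt_d4
  have hlin : d ^ 2 * F + c ≤ 31415 / 10000 * ((α * d - β) / 1536 / D + 1 / 1024) := by
    simp only [div_eq_mul_inv _ D] at h1 h2 ⊢
    generalize D⁻¹ = X at *
    have hw : 0 < d₂ - d₁ := by linarith
    have m1 := mul_le_mul_of_nonneg_left h1 (sub_nonneg.2 hd₂)
    have m2 := mul_le_mul_of_nonneg_left h2 (sub_nonneg.2 hd₁)
    have m3 := mul_nonneg hF (mul_nonneg hw.le (mul_nonneg (sub_nonneg.2 hd₁) (sub_nonneg.2 hd₂)))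
    refine le_of_mul_le_mul_left ?_ hw
    nlinarith
  rw [div_le_iff₀ Real.pi_pos]
  have e : (α * d - β) / (1536 * D) = (α * d - β) / 1536 / D := by rw [div_div]
  rw [e]
  have hY : 0 ≤ (α * d - β) / 1536 / D + 1 / 1024 := by positivity
  nlinarith

lemma Efun0_bound (T d : ℝ) (hT : 5 / 7 ≤ T) (hd : 1 / 4 ≤ d) (hd' : d ≤ 5 / 8) :
    Efun 0 T d / Real.pi ≤ (640 * d - 112) / (1536 * (3 * T - 1)) + 1 / 1024 := by
  have hT0 : 0 < T := by linarith
  have he : 0 ≤ 16 * T ^ 2 - 4 := by nlinarith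
  have hF := F0_nonneg (1 / 16) T hT (by norm_num)
  have hF' := F0_nonneg (1 / 4) T hT (by norm_num)
  have hD0 : 0 < (4 * T ^ 2 + 1) ^ 2 + 1 / 16 * (16 * T ^ 2 - 4) := by positivity
  have hmono : F0 (1 / 4) T ≤ F0 (1 / 16) T := by
    unfold F0
    gcongr
    norm_num
  have v1 := u01 T hT
  have v2 := u02 T hT
  have v3 := u03 T hT
  rcases le_total d (1 / 2) with h | h
  · refine chord_aux (F0 (1 / 16) T) _ (62 / 100000) 640 112 (3 * T - 1) d (1 / 4) (1 / 2) hF hd h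
      (by norm_num) (by linarith) (by linarith) ?_ ?_
      (Efun0_le T d _ hT hd hd' (by norm_num) (mul_le_mul_of_nonneg_right (by nlinarith) he))
    · norm_num at v1 ⊢
      exact v1
    · norm_num at v2 ⊢
      exact v2
  · refine chord_aux (F0 (1 / 4) T) _ (62 / 100000) 640 112 (3 * T - 1) d (1 / 2) (5 / 8) hF' h hd'
      (by norm_num) (by linarith) (by linarith) ?_ ?_
      (Efun0_le T d _ hT hd hd' (by norm_num) (mul_le_mul_of_nonneg_right (by nlinarith) he))
    · norm_num at v2 hmono ⊢
      linarith
    · norm_num at v3 ⊢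
      exact v3

lemma Efun1_bound (T d : ℝ) (hT : 5 / 7 ≤ T) (hd : 1 / 4 ≤ d) (hd' : d ≤ 5 / 8) :
    Efun 1 T d / Real.pi ≤ (856 * d - 151) / (1536 * (3 * T + 2)) + 1 / 1024 := by
  have hT0 : 0 < T := by linarith
  rcases le_total T (3 / 2) with h | h
  · have v1 := u11 T hT h
    have v2 := u12 T hT h
    refine chord_aux (F1 (25 / 64) T) _ (43 / 100000) 856 151 (3 * T + 2) d (1 / 4) (5 / 8)
      (F1_nonneg _ T hT (by norm_num) (by norm_num)) hd hd'
      (by norm_num) (by linarith) (by linarith) ?_ ?_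
      (Efun1_le T d _ hT hd hd' (by norm_num) (by norm_num)
        (mul_le_mul_of_nonpos_right (by nlinarith) (by nlinarith)))
    · norm_num at v1 ⊢
      exact v1
    · norm_num at v2 ⊢
      exact v2
  · have v1 := u13 T h
    have v2 := u14 T h
    refine chord_aux (F1 (1 / 16) T) _ (43 / 100000) 856 151 (3 * T + 2) d (1 / 4) (5 / 8)
      (F1_nonneg _ T hT (by norm_num) (by norm_num)) hd hd'
      (by norm_num) (by linarith) (by linarith) ?_ ?_
      (Efun1_le T d _ hT hd hd' (by norm_num) (by norm_num)
        (mul_le_mul_of_nonneg_right (by nlinarith) (by nlinarith)))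
    · norm_num at v1 ⊢
      exact v1
    · norm_num at v2 ⊢
      exact v2

/-- **Lemma 2.3.** (i) For `0 ≤ δ₁ ≤ d < 9/2` and `T ≥ 5/7`, `0 < E_K(T,δ₁) ≤ E_K(T,d)`;
(ii) for `d ∈ [1/4, 5/8]` and `T ≥ 5/7`,
`E_K(T,d)/π ≤ (r₁+r₂)(640d-112)/(1536(3T-1)) + r₂((640+216)d-112-39)/(1536(3T+3-1)) + n_K/2¹⁰`. -/
theorem EK_monotone_and_bound (K : Type*) [Field K] [NumberField K] :
    (∀ T δ₁ d : ℝ, 0 ≤ δ₁ → δ₁ ≤ d → d < 9 / 2 → 5 / 7 ≤ T →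
      0 < EK (NumberField.InfinitePlace.nrRealPlaces K)
            (NumberField.InfinitePlace.nrComplexPlaces K) T δ₁ ∧
        EK (NumberField.InfinitePlace.nrRealPlaces K)
            (NumberField.InfinitePlace.nrComplexPlaces K) T δ₁
          ≤ EK (NumberField.InfinitePlace.nrRealPlaces K)
              (NumberField.InfinitePlace.nrComplexPlaces K) T d) ∧
    (∀ T d : ℝ, 1 / 4 ≤ d → d ≤ 5 / 8 → 5 / 7 ≤ T →
      EK (NumberField.InfinitePlace.nrRealPlaces K)
          (NumberField.InfinitePlace.nrComplexPlaces K) T d / Real.pi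
        ≤ ((NumberField.InfinitePlace.nrRealPlaces K : ℝ)
              + (NumberField.InfinitePlace.nrComplexPlaces K : ℝ)) *
            (640 * d - 112) / (1536 * (3 * T - 1))
          + (NumberField.InfinitePlace.nrComplexPlaces K : ℝ) *
            ((640 + 216) * d - 112 - 39) / (1536 * (3 * T + 3 - 1))
          + (Module.finrank ℚ K : ℝ) / 2 ^ 10) := by
  have hrank := NumberField.InfinitePlace.card_add_two_mul_card_eq_rank K
  have hpos : 0 < Module.finrank ℚ K := Module.finrank_pos
  have hr : (Module.finrank ℚ K : ℝ) = (NumberField.InfinitePlace.nrRealPlaces K : ℝ)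
      + 2 * (NumberField.InfinitePlace.nrComplexPlaces K : ℝ) := by
    rw [← hrank]; push_cast; ring
  have hpos' : (0 : ℝ) < Module.finrank ℚ K := by exact_mod_cast hpos
  rw [hr] at hpos' ⊢
  have h1 : (0 : ℝ) ≤ (NumberField.InfinitePlace.nrRealPlaces K : ℝ) := Nat.cast_nonneg _
  have h2 : (0 : ℝ) ≤ (NumberField.InfinitePlace.nrComplexPlaces K : ℝ) := Nat.cast_nonneg _
  unfold EK
  generalize (NumberField.InfinitePlace.nrRealPlaces K : ℝ) = r₁ at *
  generalize (NumberField.InfinitePlace.nrComplexPlaces K : ℝ) = r₂ at *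
  have h12 : 0 < r₁ + r₂ := by linarith
  constructor
  · intro T δ₁ d hδ hδd hd hT
    constructor
    · have p0 := Efun_pos 0 T δ₁ le_rfl hT hδ (by linarith)
      have p1 := Efun_pos 1 T δ₁ zero_le_one hT hδ (by linarith)
      have := mul_pos h12 p0
      have := mul_nonneg h2 p1.le
      linarith
    · exact add_le_add
        (mul_le_mul_of_nonneg_left (Efun_mono 0 T δ₁ d le_rfl hT hδ hδd hd.le) h12.le)
        (mul_le_mul_of_nonneg_left (Efun_mono 1 T δ₁ d zero_le_one hT hδ hδd hd.le) h2)
  · intro T d hd hd' hT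
    have b0 := mul_le_mul_of_nonneg_left (Efun0_bound T d hT hd hd') h12.le
    have b1 := mul_le_mul_of_nonneg_left (Efun1_bound T d hT hd hd') h2
    have e1 : (640 + 216) * d - 112 - 39 = 856 * d - 151 := by ring
    have e2 : 3 * T + 3 - 1 = 3 * T + 2 := by ring
    rw [e1, e2, add_div, mul_div_assoc, mul_div_assoc, mul_div_assoc, mul_div_assoc]
    have e3 : (r₁ + 2 * r₂) / 2 ^ 10 = (r₁ + r₂) * (1 / 1024) + r₂ * (1 / 1024) := by ring
    rw [e3]
    rw [mul_add] at b0 b1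
    linarith
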